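/- Let N be a super nebula under an ordering θ such that every star of N under θ is a 1-right middle star or a right star and every super 2-nebula of N under θ is a super left 2-nebula, and let G be a left triangular galaxy under an ordering α having exactly one triangle under α. Then there exists ε > 0 such that every {N,G}-free tournament T contains a transitive subtournament of size at least |T|^ε. -/

import Mathlib

open Finset

/-- A tournament on vertex set `Fin n`: `adj u v` means there is an arc from `u` to `v`. -/
structure Tournament (n : ℕ) where
  adj : Fin n → Fin n → Prop
  asymm : ∀ u v, adj u v → ¬ adj v u
  total : ∀ u v, u ≠ v → adj u v ∨ adj v u

namespace Tournament

variable {n N : ℕ}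

/-- The position of vertex `v` in the ordering `θ`, where `θ k` is the `k`-th vertex. -/
def pos (θ : Equiv.Perm (Fin n)) (v : Fin n) : Fin n := θ.symm v

/-- The arc `u → v` of `T` is a backward arc under the ordering `θ`. -/
def Backward (T : Tournament n) (θ : Equiv.Perm (Fin n)) (u v : Fin n) : Prop :=
  T.adj u v ∧ pos θ v < pos θ u

/-- `x` lies strictly between two elements of `L` under the ordering `θ`. -/
def BetweenSet (θ : Equiv.Perm (Fin n)) (L : Finset (Fin n)) (x : Fin n) : Prop :=
  ∃ u ∈ L, ∃ w ∈ L, pos θ u < pos θ x ∧ pos θ x < pos θ w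

/-- The induced subtournament of `T` on `s` is transitive. -/
def IsTransOn (T : Tournament n) (s : Finset (Fin n)) : Prop :=
  ∀ u ∈ s, ∀ v ∈ s, ∀ w ∈ s, T.adj u v → T.adj v w → T.adj u w

/-- The largest size of a transitive subtournament of `T` contained in `s`. -/
noncomputable def trSizeOn (T : Tournament n) (s : Finset (Fin n)) : ℕ :=
  sSup {k | ∃ t, t ⊆ s ∧ T.IsTransOn t ∧ t.card = k}

/-- `tr(T)`: the largest size of a transitive subtournament of `T`. -/
noncomputable def trSize (T : Tournament n) : ℕ := T.trSizeOn Finset.univ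

/-- `T` contains `H`: some induced subtournament of `T` is isomorphic to `H`. -/
def Contains (T : Tournament N) (H : Tournament n) : Prop :=
  ∃ f : Fin n ↪ Fin N, ∀ u v, H.adj u v ↔ T.adj (f u) (f v)

/-- `T` is `ε`-critical. -/
def EpsCritical (T : Tournament n) (ε : ℝ) : Prop :=
  ((T.trSize : ℝ) < (n : ℝ) ^ ε) ∧
  ∀ s : Finset (Fin n), s ≠ Finset.univ → ((s.card : ℝ) ^ ε ≤ (T.trSizeOn s : ℝ))

/-- `S` with center `c` is a right star of `T` under `θ`. -/
def IsRightStarAt (T : Tournament n) (θ : Equiv.Perm (Fin n)) (S : Finset (Fin n))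
    (c : Fin n) : Prop :=
  c ∈ S ∧ (S.erase c).Nonempty ∧
  (∀ v ∈ S.erase c, pos θ v < pos θ c ∧ T.adj c v) ∧
  (∀ u ∈ S, ∀ v ∈ S, T.Backward θ u v → u = c)

/-- `S` with center `c` is a left star of `T` under `θ`. -/
def IsLeftStarAt (T : Tournament n) (θ : Equiv.Perm (Fin n)) (S : Finset (Fin n))
    (c : Fin n) : Prop :=
  c ∈ S ∧ (S.erase c).Nonempty ∧
  (∀ v ∈ S.erase c, pos θ c < pos θ v ∧ T.adj v c) ∧
  (∀ u ∈ S, ∀ v ∈ S, T.Backward θ u v → v = c)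

/-- `S` with center `c` is a middle star of `T` under `θ`. -/
def IsMiddleStarAt (T : Tournament n) (θ : Equiv.Perm (Fin n)) (S : Finset (Fin n))
    (c : Fin n) : Prop :=
  c ∈ S ∧
  (∃ v ∈ S.erase c, pos θ v < pos θ c) ∧ (∃ v ∈ S.erase c, pos θ c < pos θ v) ∧
  (∀ v ∈ S.erase c, (pos θ v < pos θ c → T.adj c v) ∧ (pos θ c < pos θ v → T.adj v c)) ∧
  (∀ u ∈ S, ∀ v ∈ S, T.Backward θ u v → u = c ∨ v = c)

def IsFrontierStarAt (T : Tournament n) (θ : Equiv.Perm (Fin n)) (S : Finset (Fin n))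
    (c : Fin n) : Prop :=
  T.IsLeftStarAt θ S c ∨ T.IsRightStarAt θ S c

def IsStarAt (T : Tournament n) (θ : Equiv.Perm (Fin n)) (S : Finset (Fin n))
    (c : Fin n) : Prop :=
  T.IsLeftStarAt θ S c ∨ T.IsRightStarAt θ S c ∨ T.IsMiddleStarAt θ S c

/-- A middle star with exactly one leaf after the center (center is `u_{p-1}`). -/
def IsOneRightMiddleStarAt (T : Tournament n) (θ : Equiv.Perm (Fin n)) (S : Finset (Fin n))
    (c : Fin n) : Prop :=
  T.IsMiddleStarAt θ S c ∧ ((S.erase c).filter (fun v => pos θ c < pos θ v)).card = 1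

/-- A middle star with exactly one leaf before the center (center is `u_2`). -/
def IsOneLeftMiddleStarAt (T : Tournament n) (θ : Equiv.Perm (Fin n)) (S : Finset (Fin n))
    (c : Fin n) : Prop :=
  T.IsMiddleStarAt θ S c ∧ ((S.erase c).filter (fun v => pos θ v < pos θ c)).card = 1

/-- Kinds of super 2-nebulas. -/
inductive NebKind
  | left
  | middle
  | right

/-- Common requirements on the data of a super 2-nebula: vertex set `S`, centers `c₁, c₂`
(`c₁` before `c₂` under `θ`), leaves `L₁` incident to `c₁` and `L₂` incident to `c₂`. -/
def Super2NebCommon (θ : Equiv.Perm (Fin n)) (S : Finset (Fin n)) (c₁ c₂ : Fin n)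
    (L₁ L₂ : Finset (Fin n)) : Prop :=
  L₁.Nonempty ∧ L₂.Nonempty ∧ Disjoint L₁ L₂ ∧
  c₁ ∉ L₁ ∪ L₂ ∧ c₂ ∉ L₁ ∪ L₂ ∧ c₁ ≠ c₂ ∧
  S = insert c₁ (insert c₂ (L₁ ∪ L₂)) ∧ pos θ c₁ < pos θ c₂

/-- `S` is a super (left/middle/right) 2-nebula of `T` under `θ`, with centers `c₁, c₂` and
leaves `L₁` (incident to `c₁`) and `L₂` (incident to `c₂`). -/
def IsSuper2NebulaAt (T : Tournament n) (θ : Equiv.Perm (Fin n)) (S : Finset (Fin n))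
    (c₁ c₂ : Fin n) (L₁ L₂ : Finset (Fin n)) : NebKind → Prop
  | NebKind.middle =>
      Super2NebCommon θ S c₁ c₂ L₁ L₂ ∧
      (∀ v ∈ L₁ ∪ L₂, pos θ c₁ < pos θ v ∧ pos θ v < pos θ c₂) ∧
      (∀ v ∈ L₁, T.adj v c₁) ∧ (∀ v ∈ L₂, T.adj c₂ v) ∧ T.adj c₂ c₁ ∧
      (∀ u ∈ S, ∀ v ∈ S, T.Backward θ u v →
        (u ∈ L₁ ∧ v = c₁) ∨ (u = c₂ ∧ v ∈ L₂) ∨ (u = c₂ ∧ v = c₁))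
  | NebKind.left =>
      Super2NebCommon θ S c₁ c₂ L₁ L₂ ∧
      (∀ v ∈ L₁ ∪ L₂, pos θ v < pos θ c₁) ∧
      (∀ v ∈ L₁, T.adj c₁ v) ∧ (∀ v ∈ L₂, T.adj c₂ v) ∧ T.adj c₂ c₁ ∧
      (∀ u ∈ S, ∀ v ∈ S, T.Backward θ u v →
        (u = c₁ ∧ v ∈ L₁) ∨ (u = c₂ ∧ v ∈ L₂) ∨ (u = c₂ ∧ v = c₁))
  | NebKind.right =>
      Super2NebCommon θ S c₁ c₂ L₁ L₂ ∧
      (∀ v ∈ L₁ ∪ L₂, pos θ c₂ < pos θ v) ∧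
      (∀ v ∈ L₁, T.adj v c₁) ∧ (∀ v ∈ L₂, T.adj v c₂) ∧ T.adj c₂ c₁ ∧
      (∀ u ∈ S, ∀ v ∈ S, T.Backward θ u v →
        (u ∈ L₁ ∧ v = c₁) ∨ (u ∈ L₂ ∧ v = c₂) ∨ (u = c₂ ∧ v = c₁))

/-- A decomposition of `T` witnessing that `T` is a super nebula under `θ`, with stars
`Q i` (centers `ctr i`) and super 2-nebulas `Sig i` (centers `c₁ i, c₂ i`, leaves
`L₁ i, L₂ i`, of kind `kd i`). -/
def SuperNebulaDecomp (T : Tournament n) (θ : Equiv.Perm (Fin n)) {m l : ℕ}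
    (Q : Fin m → Finset (Fin n)) (ctr : Fin m → Fin n)
    (Sig : Fin l → Finset (Fin n)) (c₁ c₂ : Fin l → Fin n)
    (L₁ L₂ : Fin l → Finset (Fin n)) (kd : Fin l → NebKind) : Prop :=
  (∀ i, T.IsStarAt θ (Q i) (ctr i)) ∧
  (∀ i, T.IsSuper2NebulaAt θ (Sig i) (c₁ i) (c₂ i) (L₁ i) (L₂ i) (kd i)) ∧
  (∀ i j, i ≠ j → Disjoint (Q i) (Q j)) ∧
  (∀ i j, i ≠ j → Disjoint (Sig i) (Sig j)) ∧
  (∀ i j, Disjoint (Q i) (Sig j)) ∧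
  (∀ u v, T.Backward θ u v → (∃ i, u ∈ Q i ∧ v ∈ Q i) ∨ (∃ i, u ∈ Sig i ∧ v ∈ Sig i)) ∧
  (∀ i j, ¬ BetweenSet θ (L₁ j ∪ L₂ j) (ctr i)) ∧
  (∀ i j, i ≠ j → ¬ BetweenSet θ (L₁ j ∪ L₂ j) (c₁ i) ∧ ¬ BetweenSet θ (L₁ j ∪ L₂ j) (c₂ i))

/-- `T` is a super nebula. -/
def IsSuperNebula (T : Tournament n) : Prop :=
  ∃ (θ : Equiv.Perm (Fin n)) (m l : ℕ) (Q : Fin m → Finset (Fin n)) (ctr : Fin m → Fin n)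
    (Sig : Fin l → Finset (Fin n)) (c₁ c₂ : Fin l → Fin n)
    (L₁ L₂ : Fin l → Finset (Fin n)) (kd : Fin l → NebKind),
    SuperNebulaDecomp T θ Q ctr Sig c₁ c₂ L₁ L₂ kd

/-- `{a, b, c}` (in this position order) is a triangle of `T` under `θ`:
`a` is the left exterior, `b` the center, `c` the right exterior. -/
def IsTriangleAt (T : Tournament n) (θ : Equiv.Perm (Fin n)) (a b c : Fin n) : Prop :=
  pos θ a < pos θ b ∧ pos θ b < pos θ c ∧ T.adj b a ∧ T.adj c a ∧ T.adj c b

/-- A decomposition of `T` under `θ` into triangles `{A i, B i, C i}` (left exterior, center,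
right exterior) and frontier stars `Q j` with centers `ctr j`, where for each triangle `i`,
the vertices in `forb i` are not allowed to lie between leaves of a star. -/
def TriGalaxyDecomp (T : Tournament n) (θ : Equiv.Perm (Fin n)) {l k : ℕ}
    (A B C : Fin l → Fin n) (Q : Fin k → Finset (Fin n)) (ctr : Fin k → Fin n)
    (forb : Fin l → Finset (Fin n)) : Prop :=
  (∀ i, T.IsTriangleAt θ (A i) (B i) (C i)) ∧
  (∀ j, T.IsFrontierStarAt θ (Q j) (ctr j)) ∧
  (∀ i j, i ≠ j →
    Disjoint ({A i, B i, C i} : Finset (Fin n)) ({A j, B j, C j} : Finset (Fin n))) ∧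
  (∀ i j, Disjoint ({A i, B i, C i} : Finset (Fin n)) (Q j)) ∧
  (∀ i j, i ≠ j → Disjoint (Q i) (Q j)) ∧
  (∀ u v, T.Backward θ u v →
    (∃ i, u ∈ ({A i, B i, C i} : Finset (Fin n)) ∧ v ∈ ({A i, B i, C i} : Finset (Fin n))) ∨
    (∃ j, u ∈ Q j ∧ v ∈ Q j)) ∧
  (∀ i j, i ≠ j → ¬ BetweenSet θ ((Q j).erase (ctr j)) (ctr i)) ∧
  (∀ i j, ∀ x ∈ forb i, ¬ BetweenSet θ ((Q j).erase (ctr j)) x)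

/-- `T` is a Δgalaxy: a triangular galaxy with exactly one triangle. -/
def IsDeltaGalaxy (T : Tournament n) : Prop :=
  ∃ (θ : Equiv.Perm (Fin n)) (a b c : Fin n) (k : ℕ)
    (Q : Fin k → Finset (Fin n)) (ctr : Fin k → Fin n),
    TriGalaxyDecomp T θ (fun _ : Fin 1 => a) (fun _ => b) (fun _ => c) Q ctr
      (fun _ => ({a, b, c} : Finset (Fin n)))

/-- `T` is a central triangular galaxy: centers of triangles may lie between leaves of stars. -/
def IsCentralTriangularGalaxy (T : Tournament n) : Prop :=
  ∃ (θ : Equiv.Perm (Fin n)) (l k : ℕ) (A B C : Fin l → Fin n)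
    (Q : Fin k → Finset (Fin n)) (ctr : Fin k → Fin n),
    TriGalaxyDecomp T θ A B C Q ctr (fun i => ({A i, C i} : Finset (Fin n)))

/-- `T` is a left triangular galaxy: left exteriors of triangles may lie between leaves. -/
def IsLeftTriangularGalaxy (T : Tournament n) : Prop :=
  ∃ (θ : Equiv.Perm (Fin n)) (l k : ℕ) (A B C : Fin l → Fin n)
    (Q : Fin k → Finset (Fin n)) (ctr : Fin k → Fin n),
    TriGalaxyDecomp T θ A B C Q ctr (fun i => ({B i, C i} : Finset (Fin n)))

/-- `T` is a right triangular galaxy: right exteriors of triangles may lie between leaves. -/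
def IsRightTriangularGalaxy (T : Tournament n) : Prop :=
  ∃ (θ : Equiv.Perm (Fin n)) (l k : ℕ) (A B C : Fin l → Fin n)
    (Q : Fin k → Finset (Fin n)) (ctr : Fin k → Fin n),
    TriGalaxyDecomp T θ A B C Q ctr (fun i => ({A i, B i} : Finset (Fin n)))

/-- A decomposition of `T` witnessing that `T` is a nebula under `θ` (no condition on the
location of the centers of the stars). -/
def NebulaDecomp (T : Tournament n) (θ : Equiv.Perm (Fin n)) {k : ℕ}
    (Q : Fin k → Finset (Fin n)) (ctr : Fin k → Fin n) : Prop :=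
  (∀ i, T.IsStarAt θ (Q i) (ctr i)) ∧
  (∀ i j, i ≠ j → Disjoint (Q i) (Q j)) ∧
  (∀ u v, T.Backward θ u v → ∃ i, u ∈ Q i ∧ v ∈ Q i)

/-- `T` is a central nebula: a nebula all of whose stars are 3-vertex middle stars. -/
def IsCentralNebula (T : Tournament n) : Prop :=
  ∃ (θ : Equiv.Perm (Fin n)) (k : ℕ) (Q : Fin k → Finset (Fin n)) (ctr : Fin k → Fin n),
    NebulaDecomp T θ Q ctr ∧ ∀ i, T.IsMiddleStarAt θ (Q i) (ctr i) ∧ (Q i).card = 3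

/-- `T` is a super left nebula: a nebula all of whose stars are left stars. -/
def IsSuperLeftNebula (T : Tournament n) : Prop :=
  ∃ (θ : Equiv.Perm (Fin n)) (k : ℕ) (Q : Fin k → Finset (Fin n)) (ctr : Fin k → Fin n),
    NebulaDecomp T θ Q ctr ∧ ∀ i, T.IsLeftStarAt θ (Q i) (ctr i)

/-- `T` is a super right nebula: a nebula all of whose stars are right stars. -/
def IsSuperRightNebula (T : Tournament n) : Prop :=
  ∃ (θ : Equiv.Perm (Fin n)) (k : ℕ) (Q : Fin k → Finset (Fin n)) (ctr : Fin k → Fin n),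
    NebulaDecomp T θ Q ctr ∧ ∀ i, T.IsRightStarAt θ (Q i) (ctr i)

/-- `T` is an LR-Δgalaxy: a super Δgalaxy in which only the two exteriors of the triangle
may lie between leaves of a star. -/
def IsLRDeltaGalaxy (T : Tournament n) : Prop :=
  ∃ (θ : Equiv.Perm (Fin n)) (a b c : Fin n) (k : ℕ)
    (Q : Fin k → Finset (Fin n)) (ctr : Fin k → Fin n),
    TriGalaxyDecomp T θ (fun _ : Fin 1 => a) (fun _ => b) (fun _ => c) Q ctr
      (fun _ => ({b} : Finset (Fin n)))

/-- `T` is a CR-Δgalaxy. -/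
def IsCRDeltaGalaxy (T : Tournament n) : Prop :=
  ∃ (θ : Equiv.Perm (Fin n)) (a b c : Fin n) (k : ℕ)
    (Q : Fin k → Finset (Fin n)) (ctr : Fin k → Fin n),
    TriGalaxyDecomp T θ (fun _ : Fin 1 => a) (fun _ => b) (fun _ => c) Q ctr
      (fun _ => ({a} : Finset (Fin n))) ∧
    (∀ i j, i ≠ j → BetweenSet θ ((Q i).erase (ctr i)) b →
      BetweenSet θ ((Q j).erase (ctr j)) c →
      (∀ x ∈ (Q i).erase (ctr i), ¬ BetweenSet θ ((Q j).erase (ctr j)) x) ∧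
      (∀ x ∈ (Q j).erase (ctr j), ¬ BetweenSet θ ((Q i).erase (ctr i)) x)) ∧
    (∀ i, BetweenSet θ ((Q i).erase (ctr i)) b → ¬ BetweenSet θ ((Q i).erase (ctr i)) c)

/-- `T` is a CL-Δgalaxy. -/
def IsCLDeltaGalaxy (T : Tournament n) : Prop :=
  ∃ (θ : Equiv.Perm (Fin n)) (a b c : Fin n) (k : ℕ)
    (Q : Fin k → Finset (Fin n)) (ctr : Fin k → Fin n),
    TriGalaxyDecomp T θ (fun _ : Fin 1 => a) (fun _ => b) (fun _ => c) Q ctr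
      (fun _ => ({c} : Finset (Fin n))) ∧
    (∀ i j, i ≠ j → BetweenSet θ ((Q i).erase (ctr i)) b →
      BetweenSet θ ((Q j).erase (ctr j)) a →
      (∀ x ∈ (Q i).erase (ctr i), ¬ BetweenSet θ ((Q j).erase (ctr j)) x) ∧
      (∀ x ∈ (Q j).erase (ctr j), ¬ BetweenSet θ ((Q i).erase (ctr i)) x)) ∧
    (∀ i, BetweenSet θ ((Q i).erase (ctr i)) b → ¬ BetweenSet θ ((Q i).erase (ctr i)) a)

/-- A decomposition of `T` under `θ` into one super 2-nebula (of kind `kd`) and frontier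
stars, covering all of `V(T)`, witnessing that `T` is a Σ-galaxy under `θ`. -/
def SigmaGalaxyDecomp (T : Tournament n) (θ : Equiv.Perm (Fin n))
    (S : Finset (Fin n)) (c₁ c₂ : Fin n) (L₁ L₂ : Finset (Fin n)) (kd : NebKind)
    {m : ℕ} (Q : Fin m → Finset (Fin n)) (ctr : Fin m → Fin n) : Prop :=
  T.IsSuper2NebulaAt θ S c₁ c₂ L₁ L₂ kd ∧
  (∀ j, T.IsFrontierStarAt θ (Q j) (ctr j)) ∧
  (∀ i j, i ≠ j → Disjoint (Q i) (Q j)) ∧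
  (∀ j, Disjoint S (Q j)) ∧
  (∀ v, v ∈ S ∨ ∃ j, v ∈ Q j) ∧
  (∀ u v, T.Backward θ u v → (u ∈ S ∧ v ∈ S) ∨ ∃ j, u ∈ Q j ∧ v ∈ Q j) ∧
  (∀ j, ¬ BetweenSet θ (L₁ ∪ L₂) (ctr j)) ∧
  (∀ j, ¬ BetweenSet θ ((Q j).erase (ctr j)) c₁ ∧ ¬ BetweenSet θ ((Q j).erase (ctr j)) c₂) ∧
  (∀ i j, i ≠ j → ¬ BetweenSet θ ((Q j).erase (ctr j)) (ctr i))

def IsMiddleSigmaGalaxy (T : Tournament n) : Prop :=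
  ∃ (θ : Equiv.Perm (Fin n)) (S : Finset (Fin n)) (c₁ c₂ : Fin n) (L₁ L₂ : Finset (Fin n))
    (m : ℕ) (Q : Fin m → Finset (Fin n)) (ctr : Fin m → Fin n),
    SigmaGalaxyDecomp T θ S c₁ c₂ L₁ L₂ NebKind.middle Q ctr

def IsLeftSigmaGalaxy (T : Tournament n) : Prop :=
  ∃ (θ : Equiv.Perm (Fin n)) (S : Finset (Fin n)) (c₁ c₂ : Fin n) (L₁ L₂ : Finset (Fin n))
    (m : ℕ) (Q : Fin m → Finset (Fin n)) (ctr : Fin m → Fin n),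
    SigmaGalaxyDecomp T θ S c₁ c₂ L₁ L₂ NebKind.left Q ctr

def IsRightSigmaGalaxy (T : Tournament n) : Prop :=
  ∃ (θ : Equiv.Perm (Fin n)) (S : Finset (Fin n)) (c₁ c₂ : Fin n) (L₁ L₂ : Finset (Fin n))
    (m : ℕ) (Q : Fin m → Finset (Fin n)) (ctr : Fin m → Fin n),
    SigmaGalaxyDecomp T θ S c₁ c₂ L₁ L₂ NebKind.right Q ctr

/-- The directed density from `X` to `Y`. -/
noncomputable def density (T : Tournament n) (X Y : Finset (Fin n)) : ℝ :=
  (Set.ncard {p : Fin n × Fin n | p.1 ∈ X ∧ p.2 ∈ Y ∧ T.adj p.1 p.2} : ℝ) /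
    ((X.card : ℝ) * (Y.card : ℝ))

/-- `(S i)` is a smooth `(c, lam, w)`-structure of `T`. -/
def IsSmoothStructure (T : Tournament n) (c lam : ℝ) {N : ℕ} (w : Fin N → Bool)
    (S : Fin N → Finset (Fin n)) : Prop :=
  (∀ i j, i ≠ j → Disjoint (S i) (S j)) ∧
  (∀ i, w i = false → c * (n : ℝ) ≤ ((S i).card : ℝ)) ∧
  (∀ i, w i = true → T.IsTransOn (S i) ∧ c * (T.trSize : ℝ) ≤ ((S i).card : ℝ)) ∧
  (∀ i j, i < j →
    (∀ v ∈ S i, 1 - lam ≤ T.density {v} (S j)) ∧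
    (∀ v ∈ S j, 1 - lam ≤ T.density (S i) {v}))

end Tournament

/-- The backward arcs of `K₆` under its canonical ordering. -/
def K6back : List (ℕ × ℕ) := [(3, 0), (5, 2), (5, 0), (4, 1)]

/-- The tournament `K₆`, on `Fin 6` with its canonical ordering. -/
def K6 : Tournament 6 where
  adj u v := (u.val, v.val) ∈ K6back ∨ (u < v ∧ (v.val, u.val) ∉ K6back)
  asymm := by decide
  total := by decide

/-- The pair `{H₁, H₂}` satisfies the Erdős–Hajnal conjecture: there is `ε > 0` such that
every `{H₁, H₂}`-free tournament `T` has a transitive subtournament of size `≥ |T| ^ ε`. -/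
def EHPair {n₁ n₂ : ℕ} (H₁ : Tournament n₁) (H₂ : Tournament n₂) : Prop :=
  ∃ ε : ℝ, 0 < ε ∧ ∀ (n : ℕ) (T : Tournament n),
    ¬ T.Contains H₁ → ¬ T.Contains H₂ → (n : ℝ) ^ ε ≤ (T.trSize : ℝ)

open Tournament

namespace Tournament

section Embedding

open scoped Classical

theorem not_adj_self {n : ℕ} (T : Tournament n) (v : Fin n) : ¬ T.adj v v :=
  fun hv => T.asymm v v hv hv

theorem adj_of_not_adj {n : ℕ} (T : Tournament n) {u v : Fin n} (hne : u ≠ v)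
    (huv : ¬ T.adj u v) : T.adj v u :=
  (T.total u v hne).resolve_left huv

theorem contains_of_hom {h n : ℕ} (H : Tournament h) (T : Tournament n) (f : Fin h → Fin n)
    (hf : ∀ u v, H.adj u v → T.adj (f u) (f v)) : T.Contains H := by
  have hinj : Function.Injective f := by
    intro u v huv
    by_contra hne
    rcases H.total u v hne with h1 | h1
    · have := hf _ _ h1
      rw [huv] at this
      exact T.not_adj_self _ this
    · have := hf _ _ h1
      rw [huv] at this
      exact T.not_adj_self _ this
  refine ⟨⟨f, hinj⟩, fun u v => ⟨hf u v, fun hT => ?_⟩⟩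
  by_contra hH
  have hne : u ≠ v := by
    rintro rfl
    exact T.not_adj_self _ hT
  exact T.asymm _ _ hT (hf _ _ (H.adj_of_not_adj hne hH))

theorem exists_source {n : ℕ} (r : Fin n → Fin n → Prop) (htot : ∀ u v, u ≠ v → r u v ∨ r v u)
    (S : Finset (Fin n)) (hS : S.Nonempty)
    (htr : ∀ u ∈ S, ∀ v ∈ S, ∀ w ∈ S, r u v → r v w → r u w) :
    ∃ m ∈ S, ∀ y ∈ S, y ≠ m → r m y := by
  induction hS using Finset.Nonempty.cons_induction with
  | singleton a => exact ⟨a, by simp, by simp⟩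
  | cons a s ha hs ih =>
    obtain ⟨m, hm, hmin⟩ := ih fun u hu v hv w hw =>
      htr u (mem_cons_of_mem hu) v (mem_cons_of_mem hv) w (mem_cons_of_mem hw)
    have hne : a ≠ m := fun e => ha (e ▸ hm)
    rcases htot a m hne with h1 | h1
    · refine ⟨a, by simp, fun y hy hya => ?_⟩
      have hys : y ∈ s := (mem_cons.mp hy).resolve_left hya
      by_cases hym : y = m
      · exact hym ▸ h1
      · exact htr a (by simp) m (mem_cons_of_mem hm) y hy h1 (hmin y hys hym)
    · refine ⟨m, mem_cons_of_mem hm, fun y hy hym => ?_⟩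
      rcases mem_cons.mp hy with rfl | hys
      · exact h1
      · exact hmin y hys hym

theorem exists_initial {n : ℕ} (r : Fin n → Fin n → Prop) (htot : ∀ u v, u ≠ v → r u v ∨ r v u)
    (S : Finset (Fin n)) (htr : ∀ u ∈ S, ∀ v ∈ S, ∀ w ∈ S, r u v → r v w → r u w)
    (q : ℕ) (hq : q ≤ S.card) :
    ∃ Y ⊆ S, Y.card = q ∧ ∀ x ∈ Y, ∀ y ∈ S \ Y, r x y := by
  induction q with
  | zero => exact ⟨∅, by simp, by simp, by simp⟩
  | succ q ih =>
    obtain ⟨Y, hYS, hYc, hY⟩ := ih (by omega)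
    have hne : (S \ Y).Nonempty := by
      rw [← Finset.card_pos, card_sdiff_of_subset hYS]
      omega
    obtain ⟨m, hm, hmin⟩ := exists_source r htot (S \ Y) hne fun u hu v hv w hw =>
      htr u (sdiff_subset hu) v (sdiff_subset hv) w (sdiff_subset hw)
    have hmY : m ∉ Y := (mem_sdiff.mp hm).2
    refine ⟨insert m Y, insert_subset (sdiff_subset hm) hYS, by rw [card_insert_of_notMem hmY, hYc],
      fun x hx y hy => ?_⟩
    have hy' : y ∈ S \ Y ∧ y ≠ m := by
      simp only [mem_sdiff, mem_insert, not_or] at hy ⊢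
      tauto
    rcases mem_insert.mp hx with rfl | hx
    · exact hmin y hy'.1 hy'.2
    · exact hY x hx y hy'.1

/-- A transitive set can be cut into consecutive pieces of equal size. -/
theorem exists_pieces {n : ℕ} (r : Fin n → Fin n → Prop)
    (htot : ∀ u v, u ≠ v → r u v ∨ r v u) (P q : ℕ) (S : Finset (Fin n))
    (htr : ∀ u ∈ S, ∀ v ∈ S, ∀ w ∈ S, r u v → r v w → r u w) (hq : P * q ≤ S.card) :
    ∃ Y : ℕ → Finset (Fin n), (∀ i < P, Y i ⊆ S ∧ (Y i).card = q) ∧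
      ∀ i j, i < j → j < P → ∀ x ∈ Y i, ∀ y ∈ Y j, r x y := by
  induction P generalizing S with
  | zero => exact ⟨fun _ => ∅, by simp, by simp⟩
  | succ P ih =>
    have hq' : q ≤ S.card := by nlinarith
    obtain ⟨Y0, hY0S, hY0c, hY0⟩ := exists_initial r htot S htr q hq'
    obtain ⟨Y, hY, hYr⟩ := ih (S \ Y0) (fun u hu v hv w hw =>
      htr u (sdiff_subset hu) v (sdiff_subset hv) w (sdiff_subset hw)) (by
        rw [card_sdiff_of_subset hY0S, hY0c]
        rw [Nat.succ_mul] at hq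
        omega)
    refine ⟨fun i => Nat.casesOn i Y0 Y, ?_, ?_⟩
    · rintro (_ | i) hi
      · exact ⟨hY0S, hY0c⟩
      · exact ⟨(hY i (by omega)).1.trans sdiff_subset, (hY i (by omega)).2⟩
    · rintro (_ | i) (_ | j) hij hj x hx y hy
      · omega
      · exact hY0 x hx y ((hY j (by omega)).1 hy)
      · omega
      · exact hYr i j (by omega) (by omega) x hx y hy

/-- The number of pairs of `X × Y` that are not arcs from `X` to `Y`. -/
noncomputable def defect {n : ℕ} (T : Tournament n) (X Y : Finset (Fin n)) : ℕ :=
  ∑ x ∈ X, (Y.filter fun y => ¬ T.adj x y).card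

theorem defect_eq_sum_right {n : ℕ} (T : Tournament n) (X Y : Finset (Fin n)) :
    T.defect X Y = ∑ y ∈ Y, (X.filter fun x => ¬ T.adj x y).card :=
  Finset.sum_card_bipartiteAbove_eq_sum_card_bipartiteBelow fun x y => ¬ T.adj x y

theorem defect_mono {n : ℕ} (T : Tournament n) {X X' Y Y' : Finset (Fin n)} (hX : X' ⊆ X)
    (hY : Y' ⊆ Y) : T.defect X' Y' ≤ T.defect X Y :=
  (Finset.sum_le_sum fun _ _ => card_le_card (filter_subset_filter _ hY)).trans
    (Finset.sum_le_sum_of_subset hX)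

theorem exists_dense_pair {h : ℕ} (H : Tournament h) (lam : ℝ) (hlam : 0 < lam)
    (hlam1 : lam ≤ 1) :
    ∃ c : ℝ, 0 < c ∧ c ≤ 1 ∧ ∀ (n : ℕ) (T : Tournament n) (W : Finset (Fin n)),
      ¬ T.Contains H → 1 ≤ c * W.card →
      ∃ A B, A ⊆ W ∧ B ⊆ W ∧ Disjoint A B ∧ c * W.card ≤ A.card ∧ c * W.card ≤ B.card ∧
        (T.defect A B : ℝ) ≤ lam * A.card * B.card := by
  rcases Nat.eq_zero_or_pos h with rfl | hpos
  · exact ⟨1, one_pos, le_rfl, fun n T W hT _ =>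
      absurd (contains_of_hom H T (fun i => i.elim0) fun i => i.elim0) hT⟩
  have hh : (1 : ℝ) ≤ h := by exact_mod_cast hpos
  have hlamh : 0 < lam ^ h := pow_pos hlam h
  have hlamh1 : lam ^ h ≤ 1 := pow_le_one₀ hlam.le hlam1
  have hcle : lam ^ h / (2 * h * h) ≤ 1 / (2 * h) := by
    rw [div_le_div_iff₀ (by positivity) (by positivity)]
    nlinarith [mul_nonneg (sub_nonneg.2 hlamh1) (show (0 : ℝ) ≤ h by linarith)]
  refine ⟨lam ^ h / (2 * h * h), by positivity, hcle.trans ?_, fun n T W hT hW => ?_⟩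
  · rw [div_le_one (by positivity)]
    linarith
  by_contra! hcon
  set c := lam ^ h / (2 * h * h) with hc
  have hcpos : 0 < c := by positivity
  obtain ⟨q, hq⟩ : ∃ q, q = W.card / h := ⟨_, rfl⟩
  have hWh : (2 * h : ℝ) ≤ W.card := by
    have : 1 ≤ 1 / (2 * h) * (W.card : ℝ) := hW.trans (by gcongr)
    rw [one_div, inv_mul_eq_div, le_div_iff₀ (by positivity)] at this
    linarith
  have hqW : (W.card : ℝ) ≤ 2 * h * q := by
    have h1 : W.card < h * (q + 1) := by
      rw [hq]
      exact Nat.lt_mul_div_succ _ hpos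
    have h2 : (W.card : ℝ) < h * (q + 1) := by exact_mod_cast h1
    nlinarith
  obtain ⟨Y, hY, hYr⟩ := exists_pieces (n := n) (· < ·) (fun u v huv => lt_or_gt_of_ne huv) h q W
    (fun u _ v _ w _ huv hvw => lt_trans huv hvw) (by rw [hq]; exact Nat.mul_div_le _ _)
  have hdisj : ∀ i j : Fin h, i ≠ j → Disjoint (Y i) (Y j) := by
    intro i j hij
    rw [Finset.disjoint_left]
    intro x hx hx'
    rcases lt_or_gt_of_ne hij with h1 | h1
    · exact lt_irrefl _ (hYr i j h1 j.2 x hx x hx')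
    · exact lt_irrefl _ (hYr j i h1 i.2 x hx' x hx)
  have hlarge : ∀ x : ℝ, lam ^ h * q ≤ h * x → c * W.card ≤ x := by
    intro x hx
    have h1 : c * W.card ≤ lam ^ h * q / h := by
      rw [hc, div_mul_eq_mul_div, div_le_div_iff₀ (by positivity) (by positivity)]
      have := mul_le_mul_of_nonneg_left hqW (show 0 ≤ lam ^ h * h by positivity)
      nlinarith
    refine h1.trans ?_
    rw [div_le_iff₀ (by positivity)]
    linarith
  have key : ∀ D : Finset (Fin h), ∃ (f : Fin h → Fin n) (V : Fin h → Finset (Fin n)),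
      (∀ i ∈ D, ∀ j ∈ D, H.adj i j → T.adj (f i) (f j)) ∧
      ∀ j ∉ D, V j ⊆ Y j ∧ lam ^ D.card * q ≤ (V j).card ∧
        ∀ i ∈ D, ∀ u ∈ V j, (H.adj i j → T.adj (f i) u) ∧ (H.adj j i → T.adj u (f i)) := by
    intro D
    induction D using Finset.induction_on with
    | empty =>
      have hWne : W.Nonempty := by
        rw [← Finset.card_pos]
        have : (0 : ℝ) < W.card := by linarith
        exact_mod_cast this
      refine ⟨fun _ => hWne.choose, fun j => Y j, by simp, fun j _ => ⟨Subset.rfl, ?_, by simp⟩⟩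
      simp [(hY j j.2).2]
    | insert i D hi ih =>
      obtain ⟨f, V, hf, hV⟩ := ih
      have hpow : lam ^ h ≤ lam ^ D.card :=
        pow_le_pow_of_le_one hlam.le hlam1 (by simpa using card_le_univ D)
      have hVlarge : ∀ j ∉ D, lam ^ h * q ≤ (V j).card := fun j hj =>
        (by gcongr : lam ^ h * q ≤ lam ^ D.card * (q : ℝ)).trans (hV j hj).2.1
      have hex : ∃ v ∈ V i, ∀ j ∉ insert i D, lam * (V j).card ≤
          (((V j).filter fun u => (H.adj i j → T.adj v u) ∧ (H.adj j i → T.adj u v)).card : ℝ) := by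
        by_contra! hbad
        have : Nonempty (Fin h) := ⟨i⟩
        choose! J hJ hJlt using hbad
        have hfib : ∃ j ∈ (univ : Finset (Fin h)), ((V i).card : ℝ) / h ≤
            (((V i).filter fun v => J v = j).card : ℝ) := by
          refine Finset.exists_le_card_fiber_of_nsmul_le_card_of_maps_to (fun _ _ => mem_univ _)
            ⟨i, mem_univ _⟩ ?_
          rw [card_univ, Fintype.card_fin, nsmul_eq_mul]
          field_simp
          exact le_rfl
        obtain ⟨j, -, hj⟩ := hfib
        set B := (V i).filter fun v => J v = j with hB
        rw [div_le_iff₀ (by positivity)] at hj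
        have hBlarge : c * W.card ≤ B.card := hlarge _ (by
          have := hVlarge i hi
          linarith)
        have hBpos : 0 < B.card := by
          have : (0 : ℝ) < B.card := by linarith
          exact_mod_cast this
        obtain ⟨v0, hv0⟩ := Finset.card_pos.mp hBpos
        have hjD : j ∉ insert i D := (mem_filter.mp hv0).2 ▸ hJ v0 (mem_filter.mp hv0).1
        have hij : i ≠ j := fun e => hjD (by simp [e])
        have hjD' : j ∉ D := fun e => hjD (by simp [e])
        have hVj := hVlarge j hjD'
        have hVjlarge : c * W.card ≤ (V j).card := hlarge _ (by nlinarith)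
        have hBW : B ⊆ W := ((filter_subset _ _).trans (hV i hi).1).trans (hY i i.2).1
        have hVW : V j ⊆ W := (hV j hjD').1.trans (hY j j.2).1
        have hd : Disjoint B (V j) := (hdisj i j hij).mono ((filter_subset _ _).trans (hV i hi).1)
          (hV j hjD').1
        have hcount : ∀ g : Fin n → ℕ, (∀ v ∈ B, g v ≤
            ((V j).filter fun u => (H.adj i j → T.adj v u) ∧ (H.adj j i → T.adj u v)).card) →
            ((∑ v ∈ B, g v : ℕ) : ℝ) ≤ lam * B.card * (V j).card := by
          intro g hg
          rw [Nat.cast_sum]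
          calc ∑ v ∈ B, (g v : ℝ) ≤ ∑ v ∈ B, lam * (V j).card := by
                refine Finset.sum_le_sum fun v hv => ?_
                obtain ⟨hv1, hv2⟩ := mem_filter.mp hv
                have h1 := hJlt v hv1
                rw [hv2] at h1
                exact (Nat.cast_le.mpr (hg v hv)).trans h1.le
            _ = lam * B.card * (V j).card := by
                rw [sum_const, nsmul_eq_mul]
                ring
        have hneq : ∀ v ∈ B, ∀ u ∈ V j, u ≠ v := fun v hv u hu e =>
          Finset.disjoint_left.mp hd hv (e ▸ hu)
        rcases H.total i j hij with hadj | hadj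
        · refine absurd (hcon (V j) B hVW hBW hd.symm hVjlarge hBlarge) (not_lt.mpr ?_)
          rw [defect_eq_sum_right, mul_right_comm]
          refine hcount _ fun v hv => card_le_card fun u hu => ?_
          obtain ⟨hu1, hu2⟩ := mem_filter.mp hu
          exact mem_filter.mpr ⟨hu1, fun _ => T.adj_of_not_adj (hneq v hv u hu1) hu2,
            fun h' => absurd h' (H.asymm _ _ hadj)⟩
        · refine absurd (hcon B (V j) hBW hVW hd hBlarge hVjlarge) (not_lt.mpr ?_)
          rw [defect]
          refine hcount _ fun v hv => card_le_card fun u hu => ?_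
          obtain ⟨hu1, hu2⟩ := mem_filter.mp hu
          exact mem_filter.mpr ⟨hu1, fun h' => absurd h' (H.asymm _ _ hadj),
            fun _ => T.adj_of_not_adj (hneq v hv u hu1).symm hu2⟩
      obtain ⟨v, hv, hvj⟩ := hex
      refine ⟨Function.update f i v, fun j => (V j).filter fun u =>
        (H.adj i j → T.adj v u) ∧ (H.adj j i → T.adj u v), ?_, ?_⟩
      · intro a ha b hb hab
        rcases mem_insert.mp ha with rfl | ha'
        · rcases mem_insert.mp hb with rfl | hb
          · exact absurd hab (H.not_adj_self _)
          · have hba : b ≠ a := fun e => hi (e ▸ hb)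
            rw [Function.update_self, Function.update_of_ne hba]
            exact ((hV a hi).2.2 b hb v hv).2 hab
        · have hai : a ≠ i := fun e => hi (e ▸ ha')
          rw [Function.update_of_ne hai]
          rcases mem_insert.mp hb with rfl | hb
          · rw [Function.update_self]
            exact ((hV b hi).2.2 a ha' v hv).1 hab
          · have hbi : b ≠ i := fun e => hi (e ▸ hb)
            rw [Function.update_of_ne hbi]
            exact hf a ha' b hb hab
      · intro j hj
        have hjD : j ∉ D := fun e => hj (by simp [e])
        refine ⟨(filter_subset _ _).trans (hV j hjD).1, ?_, ?_⟩
        · refine le_trans ?_ (hvj j hj)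
          rw [card_insert_of_notMem hi, pow_succ', mul_assoc]
          exact mul_le_mul_of_nonneg_left (hV j hjD).2.1 hlam.le
        · intro a ha u hu
          obtain ⟨hu1, hu2⟩ := mem_filter.mp hu
          rcases mem_insert.mp ha with rfl | ha
          · rw [Function.update_self]
            exact hu2
          · have hai : a ≠ i := fun e => hi (e ▸ ha)
            rw [Function.update_of_ne hai]
            exact (hV j hjD).2.2 a ha u hu1
  obtain ⟨f, V, hf, -⟩ := key univ
  exact hT (contains_of_hom H T f fun u v => hf u (mem_univ _) v (mem_univ _))

/-- Excluding a tournament yields long sequences of linear sets that are almost complete to each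
other in the forward direction. -/
theorem exists_dense_sequence {h : ℕ} (H : Tournament h) (M : ℕ) (lam : ℝ) (hlam : 0 < lam)
    (hlam1 : lam ≤ 1) :
    ∃ c : ℝ, 0 < c ∧ c ≤ 1 ∧ ∀ (n : ℕ) (T : Tournament n) (W : Finset (Fin n)),
      ¬ T.Contains H → 1 ≤ c * W.card →
      ∃ U : ℕ → Finset (Fin n), (∀ i < M, U i ⊆ W ∧ c * W.card ≤ (U i).card) ∧
        ∀ i j, i < j → j < M → Disjoint (U i) (U j) ∧
          (T.defect (U i) (U j) : ℝ) ≤ lam * (U i).card * (U j).card := by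
  induction M with
  | zero => exact ⟨1, one_pos, le_rfl, fun n T W _ _ => ⟨fun _ => ∅, by simp, by simp⟩⟩
  | succ M ih =>
    obtain ⟨c, hc, hc1, hseq⟩ := ih
    obtain ⟨d, hd, hd1, hpair⟩ := exists_dense_pair H (lam * c) (by positivity)
      (mul_le_one₀ hlam1 hc.le hc1)
    refine ⟨d * c, by positivity, mul_le_one₀ hd1 hc.le hc1, fun n T W hT hW => ?_⟩
    have hdW : d * c * W.card ≤ d * W.card := by
      have : d * c ≤ d * 1 := by gcongr
      nlinarith [Nat.cast_nonneg (α := ℝ) W.card]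
    obtain ⟨A, B, hA, hB, hAB, hAc, hBc, hdef⟩ := hpair n T W hT (hW.trans hdW)
    have hcB : d * c * W.card ≤ c * B.card := by
      have := mul_le_mul_of_nonneg_left hBc hc.le
      linarith
    obtain ⟨U, hU, hUU⟩ := hseq n T B hT (hW.trans hcB)
    refine ⟨fun i => Nat.casesOn i A U, ?_, ?_⟩
    · rintro (_ | i) hi
      · exact ⟨hA, hdW.trans hAc⟩
      · exact ⟨(hU i (by omega)).1.trans hB, hcB.trans (hU i (by omega)).2⟩
    · rintro (_ | i) (_ | j) hij hj
      · omega
      · obtain ⟨hj1, hj2⟩ := hU j (by omega)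
        refine ⟨hAB.mono_right hj1, ?_⟩
        have h1 : (T.defect A (U j) : ℝ) ≤ T.defect A B := by
          exact_mod_cast T.defect_mono Subset.rfl hj1
        refine h1.trans (hdef.trans ?_)
        have := mul_le_mul_of_nonneg_left hj2 (show 0 ≤ lam * A.card by positivity)
        change lam * c * A.card * B.card ≤ lam * A.card * (U j).card
        linarith
      · omega
      · exact hUU i j (by omega) (by omega)

theorem card_le_trSizeOn {n : ℕ} (T : Tournament n) {s t : Finset (Fin n)} (hts : t ⊆ s)
    (ht : T.IsTransOn t) : t.card ≤ T.trSizeOn s :=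
  le_csSup ⟨s.card, by rintro k ⟨t', ht', -, rfl⟩; exact card_le_card ht'⟩ ⟨t, hts, ht, rfl⟩

theorem exists_card_eq_trSizeOn {n : ℕ} (T : Tournament n) (s : Finset (Fin n)) :
    ∃ t ⊆ s, T.IsTransOn t ∧ t.card = T.trSizeOn s :=
  Nat.sSup_mem (s := {k | ∃ t, t ⊆ s ∧ T.IsTransOn t ∧ t.card = k})
    ⟨0, ∅, by simp, by simp [IsTransOn], rfl⟩
    ⟨s.card, by rintro k ⟨t', ht', -, rfl⟩; exact card_le_card ht'⟩

theorem isTransOn_mono {n : ℕ} {T : Tournament n} {s t : Finset (Fin n)} (hts : t ⊆ s)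
    (hs : T.IsTransOn s) : T.IsTransOn t :=
  fun u hu v hv w hw => hs u (hts hu) v (hts hv) w (hts hw)

theorem isTransOn_union {n : ℕ} {T : Tournament n} {s t : Finset (Fin n)} (hs : T.IsTransOn s)
    (ht : T.IsTransOn t) (hst : ∀ x ∈ s, ∀ y ∈ t, T.adj x y) : T.IsTransOn (s ∪ t) := by
  intro u hu v hv w hw huv hvw
  rcases mem_union.mp hu with hu | hu <;> rcases mem_union.mp hv with hv | hv <;>
    rcases mem_union.mp hw with hw | hw
  · exact hs u hu v hv w hw huv hvw
  · exact hst u hu w hw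
  · exact absurd (hst w hw v hv) (T.asymm _ _ hvw)
  · exact hst u hu w hw
  · exact absurd (hst v hv u hu) (T.asymm _ _ huv)
  · exact absurd (hst v hv u hu) (T.asymm _ _ huv)
  · exact absurd (hst w hw v hv) (T.asymm _ _ hvw)
  · exact ht u hu v hv w hw huv hvw

/-- Every set of at least `2 ^ k` vertices contains a transitive set of size `k + 1`. -/
theorem exists_isTransOn_card {n : ℕ} (T : Tournament n) (k : ℕ) (W : Finset (Fin n))
    (hW : 2 ^ k ≤ W.card) : ∃ t ⊆ W, T.IsTransOn t ∧ t.card = k + 1 := by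
  induction k generalizing W with
  | zero =>
    obtain ⟨v, hv⟩ := Finset.card_pos.mp (show 0 < W.card by simpa using hW)
    exact ⟨{v}, by simpa using hv, by simp [IsTransOn], by simp⟩
  | succ k ih =>
    obtain ⟨v, hv⟩ := Finset.card_pos.mp (lt_of_lt_of_le (by positivity) hW)
    have hcard : W.card ≤ (W.filter fun u => T.adj v u).card +
        (W.filter fun u => T.adj u v).card + 1 := by
      rw [← card_erase_add_one hv]
      refine Nat.add_le_add_right (le_trans (card_le_card fun u hu => ?_) (card_union_le _ _)) 1
      obtain ⟨hu1, hu2⟩ := mem_erase.mp hu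
      rcases T.total u v hu1 with h1 | h1
      · exact mem_union_right _ (mem_filter.mpr ⟨hu2, h1⟩)
      · exact mem_union_left _ (mem_filter.mpr ⟨hu2, h1⟩)
    rw [pow_succ] at hW
    rcases le_or_gt (2 ^ k) (W.filter fun u => T.adj v u).card with h1 | h1
    · obtain ⟨t, ht, htr, htc⟩ := ih _ h1
      have hvt : ∀ y ∈ t, T.adj v y := fun y hy => (mem_filter.mp (ht hy)).2
      refine ⟨{v} ∪ t, union_subset (by simpa using hv) (ht.trans (filter_subset _ _)),
        isTransOn_union (by simp [IsTransOn]) htr (by simpa using hvt), ?_⟩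
      rw [card_union_of_disjoint, htc, card_singleton, add_comm]
      exact disjoint_singleton_left.mpr fun hv' => T.not_adj_self v (hvt v hv')
    · obtain ⟨t, ht, htr, htc⟩ := ih (W.filter fun u => T.adj u v) (by omega)
      have hvt : ∀ y ∈ t, T.adj y v := fun y hy => (mem_filter.mp (ht hy)).2
      refine ⟨t ∪ {v}, union_subset (ht.trans (filter_subset _ _)) (by simpa using hv),
        isTransOn_union htr (by simp [IsTransOn]) (by simpa using hvt), ?_⟩
      rw [card_union_of_disjoint, htc, card_singleton]
      exact disjoint_singleton_right.mpr fun hv' => T.not_adj_self v (hvt v hv')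

/-- `τ` bounds the size of the transitive subsets of `W`, and every subset of `W` of proportion
at least `δ` contains a transitive set of size almost `τ`. -/
structure NearCritical {n : ℕ} (T : Tournament n) (W : Finset (Fin n)) (τ : ℕ) (δ : ℝ) :
    Prop where
  card_le : ∀ t ⊆ W, T.IsTransOn t → t.card ≤ τ
  exists_large : ∀ X ⊆ W, δ * W.card ≤ X.card → ∃ t ⊆ X, T.IsTransOn t ∧ (1 - δ) * τ < t.card

theorem exists_nearCritical {n₁ n₂ : ℕ} (H₁ : Tournament n₁) (H₂ : Tournament n₂)
    (hEH : ¬ EHPair H₁ H₂) (δ : ℝ) (hδ : 0 < δ) (hδ1 : δ < 1) (K : ℕ) :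
    ∃ (n : ℕ) (T : Tournament n) (W : Finset (Fin n)) (τ : ℕ), ¬ T.Contains H₁ ∧
      ¬ T.Contains H₂ ∧ T.NearCritical W τ δ ∧ K ≤ W.card ∧ K ≤ τ := by
  have h1 : ∀ᶠ ε : ℝ in nhds 0, ((2 : ℝ) ^ K) ^ ε < 2 := by
    refine (Real.continuousAt_const_rpow (b := 0) (by positivity)).eventually_lt_const ?_
    simp
  have h2 : ∀ᶠ ε : ℝ in nhds 0, 1 - δ < δ ^ ε := by
    refine (Real.continuousAt_const_rpow (b := 0) hδ.ne').eventually_const_lt ?_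
    simpa using hδ
  obtain ⟨ε, ⟨hε1, hε2⟩, hε⟩ := (((h1.and h2).filter_mono nhdsWithin_le_nhds).and
    (self_mem_nhdsWithin (s := Set.Ioi (0 : ℝ)))).exists
  replace hε : 0 < ε := hε
  simp only [EHPair, not_exists, not_and, not_forall, not_le] at hEH
  obtain ⟨n, T, hT1, hT2, hlt⟩ := hEH ε hε
  have hne : {W : Finset (Fin n) | (T.trSizeOn W : ℝ) < (W.card : ℝ) ^ ε}.Nonempty :=
    ⟨univ, by simpa [trSize] using hlt⟩
  obtain ⟨W, hW, hmin⟩ := WellFounded.has_min (wellFounded_lt (α := Finset (Fin n))) _ hne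
  rw [Set.mem_ofPred_eq] at hW
  have hram : ∀ k, 2 ^ k ≤ W.card → k + 1 ≤ T.trSizeOn W := by
    intro k hk
    obtain ⟨t, ht, htr, htc⟩ := T.exists_isTransOn_card k W hk
    exact htc ▸ T.card_le_trSizeOn ht htr
  have hW1 : 1 ≤ W.card := by
    by_contra h0
    have : W.card = 0 := by omega
    rw [this, Nat.cast_zero, Real.zero_rpow hε.ne'] at hW
    exact absurd hW (not_lt.mpr (Nat.cast_nonneg _))
  have hτ1 : 1 ≤ T.trSizeOn W := hram 0 (by simpa using hW1)
  have hW2 : 2 ≤ W.card := by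
    by_contra h0
    have : W.card = 1 := by omega
    rw [this, Nat.cast_one, Real.one_rpow] at hW
    have : (1 : ℝ) ≤ T.trSizeOn W := by exact_mod_cast hτ1
    linarith
  have hWK : 2 ^ K < W.card := by
    by_contra! h0
    have h3 : (2 : ℝ) ≤ T.trSizeOn W := by exact_mod_cast hram 1 (by simpa using hW2)
    have h4 : (W.card : ℝ) ^ ε ≤ ((2 : ℝ) ^ K) ^ ε :=
      Real.rpow_le_rpow (Nat.cast_nonneg _) (by exact_mod_cast h0) hε.le
    linarith
  refine ⟨n, T, W, T.trSizeOn W, hT1, hT2, ⟨fun t ht htr => T.card_le_trSizeOn ht htr,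
    fun X hX hXc => ?_⟩, (K.lt_two_pow_self.trans hWK).le, (Nat.le_succ K).trans (hram K hWK.le)⟩
  obtain ⟨t, ht, htr, htc⟩ := T.exists_card_eq_trSizeOn X
  refine ⟨t, ht, htr, ?_⟩
  have hτ0 : (0 : ℝ) < T.trSizeOn W := by exact_mod_cast hτ1
  rcases hX.eq_or_ssubset with rfl | hss
  · rw [htc]
    nlinarith
  · have h3 : (X.card : ℝ) ^ ε ≤ T.trSizeOn X := not_lt.mp fun h' => hmin X h' hss
    have h4 : (δ * W.card) ^ ε ≤ (X.card : ℝ) ^ ε :=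
      Real.rpow_le_rpow (by positivity) hXc hε.le
    rw [Real.mul_rpow hδ.le (Nat.cast_nonneg _)] at h4
    have h5 : (1 - δ) * T.trSizeOn W < δ ^ ε * (W.card : ℝ) ^ ε :=
      mul_lt_mul'' hε2 hW (by linarith) hτ0.le
    rw [htc]
    linarith

/-- Every vertex of `X` is complete to `Y` up to a proportion `μ`, and vice versa. -/
def Smooth {n : ℕ} (T : Tournament n) (μ : ℝ) (X Y : Finset (Fin n)) : Prop :=
  (∀ x ∈ X, ((Y.filter fun y => ¬ T.adj x y).card : ℝ) ≤ μ * Y.card) ∧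
  ∀ y ∈ Y, ((X.filter fun x => ¬ T.adj x y).card : ℝ) ≤ μ * X.card

theorem card_filter_le_of_subset {n : ℕ} {μ μ' r : ℝ} (hμ : 0 ≤ μ) (hμ' : μ * r ≤ μ')
    {Z Z' : Finset (Fin n)} (p : Fin n → Prop) [DecidablePred p] (hZ : Z' ⊆ Z)
    (hZr : (Z.card : ℝ) ≤ r * Z'.card) (hp : ((Z.filter p).card : ℝ) ≤ μ * Z.card) :
    ((Z'.filter p).card : ℝ) ≤ μ' * Z'.card := by
  have h1 : ((Z'.filter p).card : ℝ) ≤ (Z.filter p).card := by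
    exact_mod_cast card_le_card (filter_subset_filter _ hZ)
  have h2 := mul_le_mul_of_nonneg_left hZr hμ
  have h3 := mul_le_mul_of_nonneg_right hμ' (Nat.cast_nonneg (α := ℝ) Z'.card)
  linarith

theorem Smooth.mono {n : ℕ} {T : Tournament n} {μ μ' r : ℝ} {X Y X' Y' : Finset (Fin n)}
    (hs : T.Smooth μ X Y) (hμ : 0 ≤ μ) (hμ' : μ * r ≤ μ') (hX : X' ⊆ X) (hY : Y' ⊆ Y)
    (hXr : (X.card : ℝ) ≤ r * X'.card) (hYr : (Y.card : ℝ) ≤ r * Y'.card) :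
    T.Smooth μ' X' Y' := by
  exact ⟨fun x hx => card_filter_le_of_subset hμ hμ' _ hY hYr (hs.1 x (hX hx)),
    fun y hy => card_filter_le_of_subset hμ hμ' _ hX hXr (hs.2 y (hY hy))⟩

theorem smooth_of_complete {n : ℕ} {T : Tournament n} {μ : ℝ} (hμ : 0 ≤ μ)
    {X Y : Finset (Fin n)} (hXY : ∀ x ∈ X, ∀ y ∈ Y, T.adj x y) : T.Smooth μ X Y := by
  constructor
  · intro x hx
    rw [filter_false_of_mem fun y hy => not_not.mpr (hXY x hx y hy)]
    simpa using by positivity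
  · intro y hy
    rw [filter_false_of_mem fun x hx => not_not.mpr (hXY x hx y hy)]
    simpa using by positivity

theorem exists_half_good {n : ℕ} (X : Finset (Fin n)) (J : Finset ℕ) (g : ℕ → Fin n → ℕ)
    (u : ℕ → ℕ) (lam μ : ℝ) (hμ : 0 < μ) (hJ : 2 * J.card * lam ≤ μ) (hu : ∀ j ∈ J, 0 < u j)
    (hg : ∀ j ∈ J, ((∑ x ∈ X, g j x : ℕ) : ℝ) ≤ lam * X.card * u j) :
    ∃ X' ⊆ X, (X.card : ℝ) ≤ 2 * X'.card ∧ ∀ x ∈ X', ∀ j ∈ J, (g j x : ℝ) ≤ μ * u j := by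
  refine ⟨X.filter fun x => ∀ j ∈ J, (g j x : ℝ) ≤ μ * u j, filter_subset _ _, ?_,
    fun x hx => (mem_filter.mp hx).2⟩
  have hbad : ∀ j ∈ J, ((X.filter fun x => ¬ (g j x : ℝ) ≤ μ * u j).card : ℝ) * μ ≤
      lam * X.card := by
    intro j hj
    have huj : (0 : ℝ) < u j := by exact_mod_cast hu j hj
    have h1 : ((X.filter fun x => ¬ (g j x : ℝ) ≤ μ * u j).card : ℝ) * (μ * u j) ≤
        lam * X.card * u j := by
      refine le_trans ?_ (hg j hj)
      rw [Nat.cast_sum, ← nsmul_eq_mul]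
      refine (Finset.card_nsmul_le_sum _ (fun x => (g j x : ℝ)) _ fun x hx =>
        (not_le.mp (mem_filter.mp hx).2).le).trans ?_
      exact Finset.sum_le_sum_of_subset_of_nonneg (filter_subset _ _)
        fun x _ _ => Nat.cast_nonneg _
    rw [← mul_assoc] at h1
    exact le_of_mul_le_mul_right h1 huj
  have hcover : (X.filter fun x => ¬ ∀ j ∈ J, (g j x : ℝ) ≤ μ * u j).card ≤
      ∑ j ∈ J, (X.filter fun x => ¬ (g j x : ℝ) ≤ μ * u j).card := by
    refine (card_le_card fun x hx => ?_).trans card_biUnion_le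
    obtain ⟨hx1, hx2⟩ := mem_filter.mp hx
    push Not at hx2
    obtain ⟨j, hj, hjx⟩ := hx2
    exact mem_biUnion.mpr ⟨j, hj, mem_filter.mpr ⟨hx1, not_le.mpr hjx⟩⟩
  have hsum : ((X.filter fun x => ¬ ∀ j ∈ J, (g j x : ℝ) ≤ μ * u j).card : ℝ) * μ ≤
      J.card * (lam * X.card) := by
    calc _ ≤ ((∑ j ∈ J, (X.filter fun x => ¬ (g j x : ℝ) ≤ μ * u j).card : ℕ) : ℝ) * μ := by
          gcongr
      _ = ∑ j ∈ J, ((X.filter fun x => ¬ (g j x : ℝ) ≤ μ * u j).card : ℝ) * μ := by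
          rw [Nat.cast_sum, Finset.sum_mul]
      _ ≤ ∑ j ∈ J, lam * X.card := Finset.sum_le_sum hbad
      _ = _ := by rw [sum_const, nsmul_eq_mul]
  have hsplit := card_filter_add_card_filter_not (s := X)
    (fun x => ∀ j ∈ J, (g j x : ℝ) ≤ μ * u j)
  have hsplit' : (((X.filter fun x => ∀ j ∈ J, (g j x : ℝ) ≤ μ * u j).card : ℝ) +
      (X.filter fun x => ¬ ∀ j ∈ J, (g j x : ℝ) ≤ μ * u j).card : ℝ) = X.card := by
    exact_mod_cast hsplit
  have h4 := mul_le_mul_of_nonneg_right hJ (Nat.cast_nonneg (α := ℝ) X.card)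
  have h5 : ((X.filter fun x => ¬ ∀ j ∈ J, (g j x : ℝ) ≤ μ * u j).card : ℝ) * 2 ≤ X.card := by
    refine le_of_mul_le_mul_right ?_ hμ
    linarith
  linarith

/-- The number of vertices of `U j` not joined to `x` in the direction given by the order of the
indices `i`, `j`. -/
noncomputable def backDeg {n : ℕ} (T : Tournament n) (U : ℕ → Finset (Fin n)) (i j : ℕ)
    (x : Fin n) : ℕ :=
  if i < j then ((U j).filter fun y => ¬ T.adj x y).card
  else ((U j).filter fun y => ¬ T.adj y x).card

theorem exists_half_backDeg {n : ℕ} (T : Tournament n) (U : ℕ → Finset (Fin n)) (M : ℕ)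
    (lam L : ℝ) (hlam : 0 < lam) (hL : 2 * M ≤ L) (hM : 0 < M)
    (hpos : ∀ i < M, 0 < (U i).card)
    (hU : ∀ i j, i < j → j < M → (T.defect (U i) (U j) : ℝ) ≤ lam * (U i).card * (U j).card)
    (i : ℕ) (hi : i < M) :
    ∃ X ⊆ U i, ((U i).card : ℝ) ≤ 2 * X.card ∧
      ∀ x ∈ X, ∀ j < M, j ≠ i → (T.backDeg U i j x : ℝ) ≤ L * lam * (U j).card := by
  have hM' : (0 : ℝ) < M := by exact_mod_cast hM
  obtain ⟨X, hX, hXc, hXg⟩ := exists_half_good (U i) ((range M).erase i) (T.backDeg U i)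
    (fun j => (U j).card) lam (L * lam) (by nlinarith) (by
      gcongr
      refine le_trans ?_ hL
      gcongr
      exact (card_le_card (erase_subset _ _)).trans (card_range M).le)
    (fun j hj => hpos j (mem_range.mp (mem_erase.mp hj).2)) (fun j hj => by
      obtain ⟨hji, hjM⟩ := mem_erase.mp hj
      rw [mem_range] at hjM
      rcases lt_or_gt_of_ne hji with h1 | h1
      · simp only [backDeg, if_neg h1.not_gt]
        rw [← defect_eq_sum_right, mul_right_comm]
        exact hU j i h1 hi
      · simp only [backDeg, if_pos h1]
        exact hU i j h1 hjM)
  exact ⟨X, hX, hXc, fun x hx j hj hji => hXg x hx j (mem_erase.mpr ⟨hji, mem_range.mpr hj⟩)⟩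

theorem exists_transitive_replacement {n : ℕ} (T : Tournament n) (W : Finset (Fin n)) (τ : ℕ)
    (δ c lam L : ℝ) (M : ℕ) (hcrit : T.NearCritical W τ δ) (hδ : δ ≤ 1 / 2) (hδc : 2 * δ ≤ c)
    (hlam : 0 < lam) (hL : 2 * M ≤ L) (hL1 : 1 ≤ L) (hcW : 0 < c * W.card) (hτ : 0 < τ)
    (U : ℕ → Finset (Fin n)) (hU : ∀ i < M, U i ⊆ W ∧ c * W.card ≤ (U i).card)
    (hUU : ∀ i j, i < j → j < M →
      (T.defect (U i) (U j) : ℝ) ≤ lam * (U i).card * (U j).card) (t : ℕ) (ht : t ≤ M) :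
    ∃ V : ℕ → Finset (Fin n), (∀ i, V i ⊆ U i) ∧ (∀ i, i % 2 = 0 ∨ t ≤ i → V i = U i) ∧
      (∀ i < t, i % 2 = 1 → T.IsTransOn (V i) ∧ (τ : ℝ) ≤ 2 * (V i).card) ∧
      ∀ i j, i < j → j < M →
        (T.defect (V i) (V j) : ℝ) ≤ L ^ t * lam * (V i).card * (V j).card := by
  induction t with
  | zero => exact ⟨U, fun _ => Subset.rfl, fun _ _ => rfl, by simp, by simpa using hUU⟩
  | succ t ih =>
    obtain ⟨V, hVU, hVeq, hVtr, hVd⟩ := ih (by omega)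
    have hgrow : L ^ t * lam ≤ L ^ (t + 1) * lam := by
      gcongr
      exact Nat.le_succ t
    by_cases hpar : t % 2 = 0
    · refine ⟨V, hVU, fun i hi => hVeq i (by omega), fun i hi hi2 => hVtr i ?_ hi2,
        fun i j hij hj => (hVd i j hij hj).trans (by gcongr)⟩
      rcases Nat.lt_succ_iff_lt_or_eq.mp hi with h1 | h1
      · exact h1
      · omega
    · have hVpos : ∀ i < M, 0 < (V i).card := by
        intro i hi
        by_cases h1 : i % 2 = 0 ∨ t ≤ i
        · rw [hVeq i h1]
          have : (0 : ℝ) < (U i).card := hcW.trans_le (hU i hi).2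
          exact_mod_cast this
        · have h2 := (hVtr i (by omega) (by omega)).2
          have : (0 : ℝ) < (V i).card := by
            have : (0 : ℝ) < τ := by exact_mod_cast hτ
            linarith
          exact_mod_cast this
      obtain ⟨X, hX, hXc, hXg⟩ := T.exists_half_backDeg V M (L ^ t * lam) L (by positivity) hL
        (by omega) hVpos hVd t (by omega)
      have hVt : V t = U t := hVeq t (Or.inr le_rfl)
      obtain ⟨S, hSX, hStr, hSc⟩ := hcrit.exists_large X
        ((hX.trans (hVU t)).trans (hU t (by omega)).1) (by
          have h1 := (hU t (by omega)).2
          rw [hVt] at hXc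
          have h2 := mul_le_mul_of_nonneg_right hδc (Nat.cast_nonneg (α := ℝ) W.card)
          linarith)
      refine ⟨Function.update V t S, ?_, ?_, ?_, ?_⟩
      · intro i
        by_cases hi : i = t
        · subst hi
          rw [Function.update_self]
          exact (hSX.trans hX).trans (hVU i)
        · rw [Function.update_of_ne hi]
          exact hVU i
      · intro i hi
        rw [Function.update_of_ne (by rintro rfl; omega)]
        exact hVeq i (by omega)
      · intro i hi hi2
        by_cases hit : i = t
        · subst hit
          rw [Function.update_self]
          refine ⟨hStr, ?_⟩
          have h1 := mul_le_mul_of_nonneg_right hδ (Nat.cast_nonneg (α := ℝ) τ)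
          linarith
        · rw [Function.update_of_ne hit]
          exact hVtr i (by omega) hi2
      · intro i j hij hj
        by_cases hit : i = t
        · subst hit
          rw [Function.update_self, Function.update_of_ne hij.ne', defect, Nat.cast_sum]
          refine (Finset.sum_le_card_nsmul _ _ (L * (L ^ i * lam) * (V j).card)
            fun x hx => ?_).trans (le_of_eq ?_)
          · have h1 := hXg x (hSX hx) j hj hij.ne'
            rwa [backDeg, if_pos hij] at h1
          · rw [nsmul_eq_mul]
            ring
        · rw [Function.update_of_ne hit]
          by_cases hjt : j = t
          · subst hjt
            rw [Function.update_self, defect_eq_sum_right, Nat.cast_sum]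
            refine (Finset.sum_le_card_nsmul _ _ (L * (L ^ j * lam) * (V i).card)
              fun x hx => ?_).trans (le_of_eq ?_)
            · have h1 := hXg x (hSX hx) i (hij.trans hj) hij.ne
              rwa [backDeg, if_neg hij.not_gt] at h1
            · rw [nsmul_eq_mul]
              ring
          · rw [Function.update_of_ne hjt]
            exact (hVd i j hij hj).trans (by gcongr)

/-- A system of `M` levels, each made of one linear set and of `P` consecutive pieces of a
transitive set, such that different levels are smooth to each other in the forward direction. -/
structure LevelSystem {n : ℕ} (T : Tournament n) (W : Finset (Fin n)) (τ : ℕ) (c μ : ℝ)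
    (M P : ℕ) (B : ℕ → Option (Fin P) → Finset (Fin n)) : Prop where
  subset : ∀ i < M, ∀ o, B i o ⊆ W
  card_linear : ∀ i < M, c * W.card ≤ (B i none).card
  isTransOn : ∀ i < M, ∀ p, T.IsTransOn (B i (some p))
  card_piece : ∀ i < M, ∀ p, c * τ ≤ (B i (some p)).card
  chain : ∀ i < M, ∀ p q, p < q → ∀ x ∈ B i (some p), ∀ y ∈ B i (some q), T.adj x y
  disjoint : ∀ i j, i < j → j < M → ∀ o o', Disjoint (B i o) (B j o')
  smooth : ∀ i j, i < j → j < M → ∀ o o', T.Smooth μ (B i o) (B j o')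

theorem exists_levelSystem {h : ℕ} (H : Tournament h) (M P : ℕ) (μ : ℝ) (hμ : 0 < μ) :
    ∃ c : ℝ, 0 < c ∧ c ≤ 1 / 2 ∧ ∀ (n : ℕ) (T : Tournament n) (W : Finset (Fin n)) (τ : ℕ)
      (δ : ℝ), ¬ T.Contains H → δ ≤ c → T.NearCritical W τ δ → 1 ≤ c * W.card → 1 ≤ c * τ →
      ∃ B, T.LevelSystem W τ c μ M P B := by
  set L : ℝ := 4 * M + 1 with hLdef
  have hL1 : 1 ≤ L := by
    rw [hLdef]
    linarith [Nat.cast_nonneg (α := ℝ) M]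
  have hL2 : 2 * ((2 * M : ℕ) : ℝ) ≤ L := by
    rw [hLdef]
    push_cast
    linarith
  set r : ℝ := 4 * (P + 1) with hr
  have hr4 : 4 ≤ r := by
    rw [hr]
    linarith [Nat.cast_nonneg (α := ℝ) P]
  have hLpos : 0 < L := by linarith
  have hrpos : 0 < r := by linarith
  set lam : ℝ := min 1 (μ / (L ^ (2 * M + 1) * r)) with hlamdef
  have hlam : 0 < lam := lt_min one_pos (by positivity)
  have hlamr : L * (L ^ (2 * M) * lam) * r ≤ μ := by
    have h1 : lam ≤ μ / (L ^ (2 * M + 1) * r) := min_le_right _ _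
    rw [le_div_iff₀ (by positivity)] at h1
    calc _ = lam * (L ^ (2 * M + 1) * r) := by ring
      _ ≤ μ := h1
  obtain ⟨c0, hc0, hc01, hseq⟩ := exists_dense_sequence H (2 * M) lam hlam (min_le_left _ _)
  set c : ℝ := min (c0 / 2) (1 / (2 * r)) with hc
  have hcc0 : 2 * c ≤ c0 := by
    have : c ≤ c0 / 2 := min_le_left _ _
    linarith
  have hcr : c * (2 * r) ≤ 1 := by
    have h1 : c ≤ 1 / (2 * r) := min_le_right _ _
    rwa [le_div_iff₀ (by positivity)] at h1
  have hcpos : 0 < c := lt_min (by positivity) (by positivity)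
  refine ⟨c, hcpos, by linarith, fun n T W τ δ hT hδ hcrit hcW hcτ => ?_⟩
  have hW0 : (0 : ℝ) ≤ W.card := Nat.cast_nonneg _
  have hτ0 : (0 : ℝ) ≤ τ := Nat.cast_nonneg _
  have hcW' : c * W.card ≤ c0 * W.card := by nlinarith
  obtain ⟨U, hU, hUU⟩ := hseq n T W hT (hcW.trans hcW')
  have hτpos : 0 < τ := by
    rcases Nat.eq_zero_or_pos τ with h0 | h0
    · rw [h0] at hcτ
      norm_num at hcτ
    · exact h0
  obtain ⟨V, hVU, hVeq, hVtr, hVd⟩ := T.exists_transitive_replacement W τ δ c0 lam L (2 * M) hcrit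
    (by linarith) (by linarith) hlam hL2 hL1 (by linarith) hτpos U hU
    (fun i j hij hj => (hUU i j hij hj).2) (2 * M) le_rfl
  have hVpos : ∀ i < 2 * M, 0 < (V i).card := by
    intro i hi
    by_cases h1 : i % 2 = 0
    · rw [hVeq i (Or.inl h1)]
      have : (0 : ℝ) < (U i).card := by linarith [(hU i hi).2]
      exact_mod_cast this
    · have h2 := (hVtr i (by omega) (by omega)).2
      have : (0 : ℝ) < (V i).card := by
        have : (0 : ℝ) < τ := by exact_mod_cast hτpos
        linarith
      exact_mod_cast this
  have hclean : ∀ i : ℕ, ∃ X : Finset (Fin n), i < 2 * M → X ⊆ V i ∧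
      ((V i).card : ℝ) ≤ 2 * X.card ∧ ∀ x ∈ X, ∀ j < 2 * M, j ≠ i →
        (T.backDeg V i j x : ℝ) ≤ L * (L ^ (2 * M) * lam) * (V j).card := by
    intro i
    by_cases hi : i < 2 * M
    · obtain ⟨X, h1, h2, h3⟩ := T.exists_half_backDeg V (2 * M) (L ^ (2 * M) * lam) L
        (by positivity) hL2 (by omega) hVpos hVd i hi
      exact ⟨X, fun _ => ⟨h1, h2, h3⟩⟩
    · exact ⟨∅, fun h' => absurd h' hi⟩
  choose X hX using hclean
  have hSodd : ∀ i < M, T.IsTransOn (X (2 * i + 1)) ∧ (τ : ℝ) ≤ 4 * (X (2 * i + 1)).card := by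
    intro i hi
    obtain ⟨h1, h2⟩ := hVtr (2 * i + 1) (by omega) (by omega)
    obtain ⟨h3, h4, -⟩ := hX (2 * i + 1) (by omega)
    exact ⟨isTransOn_mono h3 h1, by linarith⟩
  have hpieces : ∀ i : ℕ, ∃ Y : ℕ → Finset (Fin n), i < M →
      (∀ p < P, Y p ⊆ X (2 * i + 1) ∧ (Y p).card = (X (2 * i + 1)).card / (P + 1)) ∧
      ∀ p q, p < q → q < P → ∀ x ∈ Y p, ∀ y ∈ Y q, T.adj x y := by
    intro i
    by_cases hi : i < M
    · obtain ⟨Y, h1, h2⟩ := exists_pieces T.adj T.total P ((X (2 * i + 1)).card / (P + 1))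
        (X (2 * i + 1)) (hSodd i hi).1
        ((Nat.mul_le_mul_right _ (Nat.le_succ P)).trans (Nat.mul_div_le _ _))
      exact ⟨Y, fun _ => ⟨h1, h2⟩⟩
    · exact ⟨fun _ => ∅, fun h' => absurd h' hi⟩
  choose Y hY using hpieces
  have hYcard : ∀ i < M, ∀ p : Fin P, ((X (2 * i + 1)).card : ℝ) * 2 ≤ r * (Y i p).card := by
    intro i hi p
    rw [((hY i hi).1 p p.2).2]
    have h1 := Nat.lt_mul_div_succ (X (2 * i + 1)).card (Nat.succ_pos P)
    have h2 : ((X (2 * i + 1)).card : ℝ) <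
        (P + 1) * (((X (2 * i + 1)).card / (P + 1) : ℕ) + 1) := by exact_mod_cast h1
    have h3 : r ≤ 2 * (X (2 * i + 1)).card := by
      have h4 := (hSodd i hi).2
      have h5 : (2 * r) ≤ τ := by
        have h6 : c * (2 * r) ≤ c * τ := hcr.trans hcτ
        exact le_of_mul_le_mul_left h6 hcpos
      linarith
    rw [hr] at h3 ⊢
    linarith
  set B : ℕ → Option (Fin P) → Finset (Fin n) := fun i o => o.elim (X (2 * i)) fun p => Y i p
    with hB
  have hBV : ∀ i < M, ∀ o, ∃ k, (k = 2 * i ∨ k = 2 * i + 1) ∧ B i o ⊆ X k ∧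
      ((V k).card : ℝ) ≤ r * (B i o).card := by
    rintro i hi (_ | p)
    · refine ⟨2 * i, Or.inl rfl, Subset.rfl, (hX (2 * i) (by omega)).2.1.trans ?_⟩
      change (2 * (X (2 * i)).card : ℝ) ≤ r * (X (2 * i)).card
      gcongr
      linarith
    · refine ⟨2 * i + 1, Or.inr rfl, ((hY i hi).1 p p.2).1,
        (hX (2 * i + 1) (by omega)).2.1.trans ?_⟩
      change (2 * (X (2 * i + 1)).card : ℝ) ≤ r * (Y i p).card
      linarith [hYcard i hi p]
  refine ⟨B, ?_, ?_, ?_, ?_, ?_, ?_, ?_⟩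
  · intro i hi o
    obtain ⟨k, hk, hBk, -⟩ := hBV i hi o
    exact hBk.trans ((hX k (by omega)).1.trans ((hVU k).trans (hU k (by omega)).1))
  · intro i hi
    have h1 := (hX (2 * i) (by omega)).2.1
    rw [hVeq (2 * i) (Or.inl (by omega))] at h1
    have h2 := (hU (2 * i) (by omega)).2
    have h3 := mul_le_mul_of_nonneg_right hcc0 hW0
    change c * W.card ≤ (X (2 * i)).card
    linarith
  · intro i hi p
    exact isTransOn_mono ((hY i hi).1 p p.2).1 (hSodd i hi).1
  · intro i hi p
    have h1 := hYcard i hi p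
    have h2 := (hSodd i hi).2
    change c * τ ≤ (Y i p).card
    have h3 := mul_le_mul_of_nonneg_right hcr hτ0
    refine le_of_mul_le_mul_left ?_ hrpos
    linarith
  · intro i hi p q hpq
    exact (hY i hi).2 p q hpq q.2
  · intro i j hij hj o o'
    obtain ⟨k, hk, hBk, -⟩ := hBV i (hij.trans hj) o
    obtain ⟨k', hk', hBk', -⟩ := hBV j hj o'
    exact (hUU k k' (by omega) (by omega)).1.mono
      (hBk.trans ((hX k (by omega)).1.trans (hVU k)))
      (hBk'.trans ((hX k' (by omega)).1.trans (hVU k')))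
  · intro i j hij hj o o'
    obtain ⟨k, hk, hBk, hk1⟩ := hBV i (hij.trans hj) o
    obtain ⟨k', hk', hBk', hk1'⟩ := hBV j hj o'
    have hkk : k < k' := by omega
    obtain ⟨hXk, -, hk2⟩ := hX k (by omega)
    obtain ⟨hXk', -, hk2'⟩ := hX k' (by omega)
    have hlam0 : 0 ≤ L * (L ^ (2 * M) * lam) := by positivity
    refine ⟨fun x hx => card_filter_le_of_subset hlam0 hlamr _ (hBk'.trans hXk') hk1' ?_,
      fun y hy => card_filter_le_of_subset hlam0 hlamr _ (hBk.trans hXk) hk1 ?_⟩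
    · have h1 := hk2 x (hBk hx) k' (by omega) hkk.ne'
      rwa [backDeg, if_pos hkk] at h1
    · have h1 := hk2' y (hBk' hy) k (by omega) hkk.ne
      rwa [backDeg, if_neg hkk.not_gt] at h1

theorem pos_injective {h : ℕ} (θ : Equiv.Perm (Fin h)) : Function.Injective (pos θ) :=
  θ.symm.injective

theorem contains_of_cover {h n : ℕ} {H : Tournament h} {T : Tournament n}
    {θ : Equiv.Perm (Fin h)} {κ : Type*} [Fintype κ] (D : κ → Finset (Fin h))
    (hcover : ∀ u, ∃ k, u ∈ D k) (hD : ∀ k k', k ≠ k' → Disjoint (D k) (D k'))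
    (hback : ∀ u v, H.Backward θ u v → ∃ k, u ∈ D k ∧ v ∈ D k) (R : Fin h → Finset (Fin n))
    (μ : ℝ) (hμ0 : 0 ≤ μ) (hμ : h * μ ≤ 1 / 2) (hn : 0 < n)
    (hsm : ∀ u v, pos θ u < pos θ v → (¬ ∃ k, u ∈ D k ∧ v ∈ D k) → T.Smooth μ (R u) (R v))
    (hfind : ∀ k, ∀ R' : Fin h → Finset (Fin n),
      (∀ v ∈ D k, R' v ⊆ R v ∧ (R v).card ≤ 2 * (R' v).card) →
      ∃ f : Fin h → Fin n, (∀ u ∈ D k, f u ∈ R' u) ∧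
        ∀ u ∈ D k, ∀ v ∈ D k, H.adj u v → T.adj (f u) (f v)) : T.Contains H := by
  have huniq : ∀ k k' u, u ∈ D k → u ∈ D k' → k = k' := fun k k' u hk hk' => by
    by_contra hne
    exact Finset.disjoint_left.mp (hD k k' hne) hk hk'
  have key : ∀ s : Finset κ, ∃ f : Fin h → Fin n, (∀ k ∈ s, ∀ u ∈ D k, f u ∈ R u) ∧
      ∀ k ∈ s, ∀ k' ∈ s, ∀ u ∈ D k, ∀ v ∈ D k', H.adj u v → T.adj (f u) (f v) := by
    intro s
    induction s using Finset.induction_on with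
    | empty => exact ⟨fun _ => ⟨0, hn⟩, by simp, by simp⟩
    | insert k s hk ih =>
      obtain ⟨f, hfR, hf⟩ := ih
      let ok : Fin h → Fin n → Fin h → Prop := fun v x u => (∃ k' ∈ s, u ∈ D k') →
        (pos θ u < pos θ v → T.adj (f u) x) ∧ (pos θ v < pos θ u → T.adj x (f u))
      obtain ⟨g, hgR, hg⟩ := hfind k (fun v => (R v).filter fun x => ∀ u, ok v x u) (by
        intro v hv
        refine ⟨filter_subset _ _, ?_⟩
        have hone : ∀ u, (((R v).filter fun x => ¬ ok v x u).card : ℝ) ≤ μ * (R v).card := by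
          intro u
          by_cases hu : ∃ k' ∈ s, u ∈ D k'
          · obtain ⟨k', hk', huk'⟩ := hu
            have hnot : ¬ ∃ k'', u ∈ D k'' ∧ v ∈ D k'' := by
              rintro ⟨k'', h1, h2⟩
              have e1 := huniq _ _ _ h1 huk'
              have e2 := huniq _ _ _ h2 hv
              exact hk (e2 ▸ e1 ▸ hk')
            have hnot' : ¬ ∃ k'', v ∈ D k'' ∧ u ∈ D k'' := fun ⟨k'', h1, h2⟩ =>
              hnot ⟨k'', h2, h1⟩
            rcases lt_trichotomy (pos θ u) (pos θ v) with hlt | heq | hlt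
            · refine le_trans ?_ ((hsm u v hlt hnot).1 (f u) (hfR k' hk' u huk'))
              refine Nat.cast_le.mpr (card_le_card fun x hx => ?_)
              obtain ⟨hx1, hx2⟩ := mem_filter.mp hx
              refine mem_filter.mpr ⟨hx1, fun hadj => hx2 fun _ =>
                ⟨fun _ => hadj, fun h' => absurd h' hlt.not_gt⟩⟩
            · rw [pos_injective θ heq] at hnot huk'
              exact absurd ⟨k', huk', huk'⟩ hnot
            · refine le_trans ?_ ((hsm v u hlt hnot').2 (f u) (hfR k' hk' u huk'))
              refine Nat.cast_le.mpr (card_le_card fun x hx => ?_)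
              obtain ⟨hx1, hx2⟩ := mem_filter.mp hx
              refine mem_filter.mpr ⟨hx1, fun hadj => hx2 fun _ =>
                ⟨fun h' => absurd h' hlt.not_gt, fun _ => hadj⟩⟩
          · rw [filter_false_of_mem fun x _ hx => hx fun h' => absurd h' hu]
            simpa using by positivity
        have hcov : (R v).card ≤ ((R v).filter fun x => ∀ u, ok v x u).card +
            ∑ u : Fin h, ((R v).filter fun x => ¬ ok v x u).card := by
          rw [← card_filter_add_card_filter_not (s := R v) (fun x => ∀ u, ok v x u)]
          refine Nat.add_le_add_left ((card_le_card fun x hx => ?_).trans card_biUnion_le) _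
          obtain ⟨hx1, hx2⟩ := mem_filter.mp hx
          obtain ⟨u, hu⟩ := not_forall.mp hx2
          exact mem_biUnion.mpr ⟨u, mem_univ _, mem_filter.mpr ⟨hx1, hu⟩⟩
        have hcov' : ((R v).card : ℝ) ≤ ((R v).filter fun x => ∀ u, ok v x u).card +
            ∑ u : Fin h, (((R v).filter fun x => ¬ ok v x u).card : ℝ) := by exact_mod_cast hcov
        have hsum : ∑ u : Fin h, (((R v).filter fun x => ¬ ok v x u).card : ℝ) ≤
            h * (μ * (R v).card) := by
          refine (Finset.sum_le_sum fun u _ => hone u).trans (le_of_eq ?_)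
          simp
        have h3 := mul_le_mul_of_nonneg_right hμ (Nat.cast_nonneg (α := ℝ) (R v).card)
        have h4 : ((R v).card : ℝ) ≤ 2 * ((R v).filter fun x => ∀ u, ok v x u).card := by
          linarith
        exact_mod_cast h4)
      have hother : ∀ k' ∈ insert k s, ∀ u ∈ D k', u ∉ D k → k' ∈ s := by
        intro k' hk' u hu hu'
        rcases mem_insert.mp hk' with rfl | h1
        · exact absurd hu hu'
        · exact h1
      refine ⟨fun u => if u ∈ D k then g u else f u, ?_, ?_⟩
      · intro k' hk' u hu
        by_cases huk : u ∈ D k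
        · simp only [if_pos huk]
          exact (mem_filter.mp (hgR u huk)).1
        · simp only [if_neg huk]
          exact hfR k' (hother k' hk' u hu huk) u hu
      · intro k1 hk1 k2 hk2 u hu v hv huv
        have hposne : pos θ u ≠ pos θ v := fun e =>
          H.not_adj_self u (by simpa [pos_injective θ e] using huv)
        by_cases huk : u ∈ D k <;> by_cases hvk : v ∈ D k
        · simp only [if_pos huk, if_pos hvk]
          exact hg u huk v hvk huv
        · simp only [if_pos huk, if_neg hvk]
          have h1 := (mem_filter.mp (hgR u huk)).2 v ⟨k2, hother k2 hk2 v hv hvk, hv⟩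
          rcases lt_or_gt_of_ne hposne with hlt | hlt
          · exact h1.2 hlt
          · obtain ⟨k3, h3, h4⟩ := hback u v ⟨huv, hlt⟩
            exact absurd (huniq _ _ _ h3 huk ▸ h4) hvk
        · simp only [if_neg huk, if_pos hvk]
          have h1 := (mem_filter.mp (hgR v hvk)).2 u ⟨k1, hother k1 hk1 u hu huk, hu⟩
          rcases lt_or_gt_of_ne hposne with hlt | hlt
          · exact h1.1 hlt
          · obtain ⟨k3, h3, h4⟩ := hback u v ⟨huv, hlt⟩
            exact absurd (huniq _ _ _ h4 hvk ▸ h3) huk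
        · simp only [if_neg huk, if_neg hvk]
          exact hf k1 (hother k1 hk1 u hu huk) k2 (hother k2 hk2 v hv hvk) u hu v hv huv
  obtain ⟨f, -, hf⟩ := key univ
  refine contains_of_hom H T f fun u v huv => ?_
  obtain ⟨k, hk⟩ := hcover u
  obtain ⟨k', hk'⟩ := hcover v
  exact hf k (mem_univ _) k' (mem_univ _) u hk v hk' huv

/-- If the backward arcs of `H` lie inside the disjoint parts `D k`, then `H` embeds into `T` as
soon as every part can be found inside large subsets of a smooth system of reservoirs. -/
theorem contains_of_parts {h n : ℕ} {H : Tournament h} {T : Tournament n}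
    {θ : Equiv.Perm (Fin h)} {κ : Type*} [Fintype κ] (D : κ → Finset (Fin h))
    (hD : ∀ k k', k ≠ k' → Disjoint (D k) (D k'))
    (hback : ∀ u v, H.Backward θ u v → ∃ k, u ∈ D k ∧ v ∈ D k) (R : Fin h → Finset (Fin n))
    (μ : ℝ) (hμ0 : 0 ≤ μ) (hμ : h * μ ≤ 1 / 2) (hn : 0 < n) (hR : ∀ v, (R v).Nonempty)
    (hsm : ∀ u v, pos θ u < pos θ v → (¬ ∃ k, u ∈ D k ∧ v ∈ D k) → T.Smooth μ (R u) (R v))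
    (hfind : ∀ k, ∀ R' : Fin h → Finset (Fin n),
      (∀ v ∈ D k, R' v ⊆ R v ∧ (R v).card ≤ 2 * (R' v).card) →
      ∃ f : Fin h → Fin n, (∀ u ∈ D k, f u ∈ R' u) ∧
        ∀ u ∈ D k, ∀ v ∈ D k, H.adj u v → T.adj (f u) (f v)) : T.Contains H := by
  let D' : κ ⊕ Fin h → Finset (Fin h) := Sum.elim D fun w => if ∃ k, w ∈ D k then ∅ else {w}
  have hmem : ∀ w u, u ∈ D' (Sum.inr w) ↔ u = w ∧ ¬ ∃ k, w ∈ D k := by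
    intro w u
    change u ∈ (if ∃ k, w ∈ D k then ∅ else {w} : Finset (Fin h)) ↔ _
    split_ifs with hw
    · simp [hw]
    · simp [hw]
  refine contains_of_cover (θ := θ) D' ?_ ?_ ?_ R μ hμ0 hμ hn ?_ ?_
  · intro u
    by_cases hu : ∃ k, u ∈ D k
    · exact ⟨Sum.inl hu.choose, hu.choose_spec⟩
    · exact ⟨Sum.inr u, (hmem u u).mpr ⟨rfl, hu⟩⟩
  · rintro (k | w) (k' | w') hne <;> rw [Finset.disjoint_left] <;> intro x hx hx'
    · exact Finset.disjoint_left.mp (hD k k' fun e => hne (e ▸ rfl)) hx hx'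
    · obtain ⟨rfl, h1⟩ := (hmem _ _).mp hx'
      exact h1 ⟨k, hx⟩
    · obtain ⟨rfl, h1⟩ := (hmem _ _).mp hx
      exact h1 ⟨k', hx'⟩
    · obtain ⟨rfl, -⟩ := (hmem _ _).mp hx
      obtain ⟨rfl, -⟩ := (hmem _ _).mp hx'
      exact hne rfl
  · intro u v huv
    obtain ⟨k, hk⟩ := hback u v huv
    exact ⟨Sum.inl k, hk⟩
  · exact fun u v huv hnot => hsm u v huv fun ⟨k, hk⟩ => hnot ⟨Sum.inl k, hk⟩
  · rintro (k | w) R' hR'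
    · exact hfind k R' hR'
    · by_cases hw : ∃ k, w ∈ D k
      · refine ⟨fun _ => ⟨0, hn⟩, fun u hu => ?_, fun u hu => ?_⟩ <;>
          exact absurd hw ((hmem _ _).mp hu).2
      · have h1 := (hR' w ((hmem w w).mpr ⟨rfl, hw⟩)).2
        have h2 := Finset.card_pos.mpr (hR w)
        obtain ⟨x, hx⟩ := Finset.card_pos.mp (show 0 < (R' w).card by omega)
        refine ⟨fun _ => x, fun u hu => ?_, fun u hu v hv huv => ?_⟩
        · rwa [((hmem _ _).mp hu).1]
        · rw [((hmem _ _).mp hu).1, ((hmem _ _).mp hv).1] at huv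
          exact absurd huv (H.not_adj_self _)

theorem NearCritical.exists_good_centers {h n : ℕ} {T : Tournament n} {W : Finset (Fin n)}
    {τ : ℕ} {δ : ℝ} (hcrit : T.NearCritical W τ δ) (X : Finset (Fin n)) (hX : X ⊆ W)
    (I : Finset (Fin h)) (Y : Fin h → Finset (Fin n)) (p : Fin h → Prop)
    (hY : ∀ i ∈ I, Y i ⊆ W ∧ T.IsTransOn (Y i) ∧ δ * τ ≤ (Y i).card ∧ Disjoint X (Y i)) :
    ∃ X' ⊆ X, (X.card : ℝ) ≤ X'.card + I.card * (δ * W.card) ∧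
      ∀ v ∈ X', ∀ i ∈ I, ∃ u ∈ Y i, (p i → T.adj v u) ∧ (¬ p i → T.adj u v) := by
  let good : Fin n → Fin h → Prop := fun v i =>
    ∃ u ∈ Y i, (p i → T.adj v u) ∧ (¬ p i → T.adj u v)
  have hbad : ∀ i ∈ I, ((X.filter fun v => ¬ good v i).card : ℝ) ≤ δ * W.card := by
    intro i hi
    by_contra! hlt
    obtain ⟨hYW, hYtr, hYc, hXY⟩ := hY i hi
    obtain ⟨t, ht, htr, htc⟩ := hcrit.exists_large _ ((filter_subset _ _).trans hX) hlt.le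
    have hd : Disjoint t (Y i) := hXY.mono_left (ht.trans (filter_subset _ _))
    have htW : t ⊆ W := ht.trans ((filter_subset _ _).trans hX)
    have hne : ∀ v ∈ t, ∀ u ∈ Y i, u ≠ v := fun v hv u hu e =>
      Finset.disjoint_left.mp hd hv (e ▸ hu)
    have hngood : ∀ v ∈ t, ¬ good v i := fun v hv => (mem_filter.mp (ht hv)).2
    have hbig : τ < t.card + (Y i).card := by
      have : (τ : ℝ) < t.card + (Y i).card := by linarith
      exact_mod_cast this
    by_cases hp : p i
    · have htrans : T.IsTransOn (Y i ∪ t) := isTransOn_union hYtr htr fun u hu v hv => by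
        by_contra hadj
        exact hngood v hv ⟨u, hu, fun _ => T.adj_of_not_adj (hne v hv u hu) hadj,
          fun h' => absurd hp h'⟩
      have := hcrit.card_le _ (union_subset hYW htW) htrans
      rw [card_union_of_disjoint hd.symm] at this
      omega
    · have htrans : T.IsTransOn (t ∪ Y i) := isTransOn_union htr hYtr fun v hv u hu => by
        by_contra hadj
        exact hngood v hv ⟨u, hu, fun h' => absurd h' hp,
          fun _ => T.adj_of_not_adj (hne v hv u hu).symm hadj⟩
      have := hcrit.card_le _ (union_subset htW hYW) htrans
      rw [card_union_of_disjoint hd] at this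
      omega
  refine ⟨X.filter fun v => ∀ i ∈ I, good v i, filter_subset _ _, ?_,
    fun v hv i hi => (mem_filter.mp hv).2 i hi⟩
  have hcov : X.card ≤ (X.filter fun v => ∀ i ∈ I, good v i).card +
      ∑ i ∈ I, (X.filter fun v => ¬ good v i).card := by
    rw [← card_filter_add_card_filter_not (s := X) (fun v => ∀ i ∈ I, good v i)]
    refine Nat.add_le_add_left ((card_le_card fun v hv => ?_).trans card_biUnion_le) _
    obtain ⟨hv1, hv2⟩ := mem_filter.mp hv
    push Not at hv2
    obtain ⟨i, hi, hiv⟩ := hv2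
    exact mem_biUnion.mpr ⟨i, hi, mem_filter.mpr ⟨hv1, hiv⟩⟩
  have hcov' : (X.card : ℝ) ≤ (X.filter fun v => ∀ i ∈ I, good v i).card +
      ∑ i ∈ I, ((X.filter fun v => ¬ good v i).card : ℝ) := by exact_mod_cast hcov
  have hsum := Finset.sum_le_card_nsmul I _ _ hbad
  rw [nsmul_eq_mul] at hsum
  linarith

theorem NearCritical.exists_adj {n : ℕ} {T : Tournament n} {W : Finset (Fin n)} {τ : ℕ} {δ : ℝ}
    (hcrit : T.NearCritical W τ δ) (hδ : δ ≤ 1 / 2) {X Y : Finset (Fin n)} (hX : X ⊆ W)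
    (hY : Y ⊆ W) (hXY : Disjoint X Y) (hXc : δ * W.card ≤ X.card) (hYc : δ * W.card ≤ Y.card) :
    ∃ x ∈ X, ∃ y ∈ Y, T.adj y x := by
  by_contra! hcon
  obtain ⟨s, hs, hstr, hsc⟩ := hcrit.exists_large X hX hXc
  obtain ⟨t, ht, httr, htc⟩ := hcrit.exists_large Y hY hYc
  have htrans : T.IsTransOn (s ∪ t) := isTransOn_union hstr httr fun x hx y hy =>
    T.adj_of_not_adj (fun e => Finset.disjoint_left.mp hXY (hs hx) (e ▸ ht hy))
      (hcon x (hs hx) y (ht hy))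
  have h1 := hcrit.card_le _ (union_subset (hs.trans hX) (ht.trans hY)) htrans
  rw [card_union_of_disjoint (hXY.mono hs ht)] at h1
  have h2 : (s.card + t.card : ℝ) ≤ τ := by exact_mod_cast h1
  have h3 := mul_le_mul_of_nonneg_right hδ (Nat.cast_nonneg (α := ℝ) τ)
  linarith

theorem NearCritical.exists_star {h n : ℕ} {H : Tournament h} {T : Tournament n}
    {θ : Equiv.Perm (Fin h)} {W : Finset (Fin n)} {τ : ℕ} {δ : ℝ} (hδ0 : 0 ≤ δ)
    (hcrit : T.NearCritical W τ δ) {Q : Finset (Fin h)} {c : Fin h} (hQ : H.IsStarAt θ Q c)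
    (R : Fin h → Finset (Fin n)) (hc : R c ⊆ W) (hcc : h * (δ * W.card) < (R c).card)
    (hleaf : ∀ i ∈ Q.erase c, R i ⊆ W ∧ T.IsTransOn (R i) ∧ δ * τ ≤ (R i).card ∧
      Disjoint (R c) (R i))
    (hfwd : ∀ i ∈ Q.erase c, ∀ j ∈ Q.erase c, pos θ i < pos θ j → ∀ v ∈ R c, ∀ x ∈ R i,
      ∀ y ∈ R j, (pos θ i < pos θ c → T.adj v x) → (pos θ c < pos θ i → T.adj x v) →
      (pos θ j < pos θ c → T.adj v y) → (pos θ c < pos θ j → T.adj y v) → T.adj x y) :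
    ∃ f : Fin h → Fin n, (∀ u ∈ Q, f u ∈ R u) ∧
      ∀ u ∈ Q, ∀ v ∈ Q, H.adj u v → T.adj (f u) (f v) := by
  have hl : ∀ i ∈ Q.erase c, (pos θ i < pos θ c → H.adj c i) ∧ (pos θ c < pos θ i → H.adj i c) := by
    intro i hi
    rcases hQ with hQ | hQ | hQ
    · exact ⟨fun h' => absurd h' (hQ.2.2.1 i hi).1.not_gt, fun _ => (hQ.2.2.1 i hi).2⟩
    · exact ⟨fun _ => (hQ.2.2.1 i hi).2, fun h' => absurd h' (hQ.2.2.1 i hi).1.not_gt⟩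
    · exact hQ.2.2.2.1 i hi
  have hb : ∀ u ∈ Q, ∀ v ∈ Q, H.Backward θ u v → u = c ∨ v = c := by
    intro u hu v hv huv
    rcases hQ with hQ | hQ | hQ
    · exact Or.inr (hQ.2.2.2 u hu v hv huv)
    · exact Or.inl (hQ.2.2.2 u hu v hv huv)
    · exact hQ.2.2.2.2 u hu v hv huv
  obtain ⟨X, hX, hXc, hXg⟩ := hcrit.exists_good_centers (R c) hc (Q.erase c) R
    (fun i => pos θ i < pos θ c) hleaf
  have hXpos : 0 < X.card := by
    have h1 : ((Q.erase c).card : ℝ) ≤ h := by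
      exact_mod_cast (card_le_univ _).trans (Fintype.card_fin h).le
    have h2 := mul_le_mul_of_nonneg_right h1 (show 0 ≤ δ * (W.card : ℝ) by positivity)
    have : (0 : ℝ) < X.card := by linarith
    exact_mod_cast this
  obtain ⟨v, hv⟩ := Finset.card_pos.mp hXpos
  have : Nonempty (Fin n) := ⟨v⟩
  choose! g hgR hg1 hg2 using hXg v hv
  have hdir : ∀ i ∈ Q.erase c, pos θ c < pos θ i → T.adj (g i) v := fun i hi hlt =>
    hg2 i hi hlt.not_gt
  refine ⟨fun i => if i = c then v else g i, fun u hu => ?_, fun i hi j hj hij => ?_⟩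
  · by_cases huc : u = c
    · simp only [huc]
      exact hX hv
    · simp only [if_neg huc]
      exact hgR u (mem_erase.mpr ⟨huc, hu⟩)
  · have hposne : ∀ {a b : Fin h}, a ≠ b → pos θ a < pos θ b ∨ pos θ b < pos θ a :=
      fun hab => lt_or_gt_of_ne fun e => hab (pos_injective θ e)
    have hne : i ≠ j := fun e => H.not_adj_self j (by simpa [e] using hij)
    by_cases hic : i = c
    · have hjc : j ≠ c := fun e => hne (hic.trans e.symm)
      have hjQ : j ∈ Q.erase c := mem_erase.mpr ⟨hjc, hj⟩
      simp only [if_pos hic, if_neg hjc]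
      rcases hposne hjc with hlt | hlt
      · exact hg1 j hjQ hlt
      · exact absurd ((hl j hjQ).2 hlt) (H.asymm _ _ (hic ▸ hij))
    · have hiQ : i ∈ Q.erase c := mem_erase.mpr ⟨hic, hi⟩
      by_cases hjc : j = c
      · simp only [if_neg hic, if_pos hjc]
        rcases hposne hic with hlt | hlt
        · exact absurd ((hl i hiQ).1 hlt) (H.asymm _ _ (hjc ▸ hij))
        · exact hdir i hiQ hlt
      · have hjQ : j ∈ Q.erase c := mem_erase.mpr ⟨hjc, hj⟩
        simp only [if_neg hic, if_neg hjc]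
        rcases hposne hne with hlt | hlt
        · exact hfwd i hiQ j hjQ hlt v (hX hv) _ (hgR i hiQ) _ (hgR j hjQ) (hg1 i hiQ)
            (hdir i hiQ) (hg1 j hjQ) (hdir j hjQ)
        · rcases hb i hi j hj ⟨hij, hlt⟩ with h1 | h1
          · exact absurd h1 hic
          · exact absurd h1 hjc

theorem NearCritical.exists_superLeft {h n : ℕ} {H : Tournament h} {T : Tournament n}
    {θ : Equiv.Perm (Fin h)} {W : Finset (Fin n)} {τ : ℕ} {δ : ℝ} (hδ0 : 0 ≤ δ) (hδ : δ ≤ 1 / 2)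
    (hcrit : T.NearCritical W τ δ) {S : Finset (Fin h)} {c₁ c₂ : Fin h} {L₁ L₂ : Finset (Fin h)}
    (hS : H.IsSuper2NebulaAt θ S c₁ c₂ L₁ L₂ NebKind.left)
    (R : Fin h → Finset (Fin n)) (hc₁ : R c₁ ⊆ W) (hc₂ : R c₂ ⊆ W)
    (hcc₁ : (h + 1) * (δ * W.card) ≤ (R c₁).card) (hcc₂ : (h + 1) * (δ * W.card) ≤ (R c₂).card)
    (hdisj : Disjoint (R c₁) (R c₂))
    (hleaf : ∀ i ∈ L₁ ∪ L₂, R i ⊆ W ∧ T.IsTransOn (R i) ∧ δ * τ ≤ (R i).card ∧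
      Disjoint (R c₁) (R i) ∧ Disjoint (R c₂) (R i))
    (hfwd : ∀ i ∈ L₁ ∪ L₂, ∀ j ∈ L₁ ∪ L₂, pos θ i < pos θ j →
      ∀ x ∈ R i, ∀ y ∈ R j, T.adj x y)
    (htri : ∀ i ∈ L₁ ∪ L₂, ∀ x ∈ R i, ∀ y ∈ R c₁, ∀ z ∈ R c₂,
      ¬ (T.adj y x ∧ T.adj z x ∧ T.adj z y)) :
    ∃ f : Fin h → Fin n, (∀ u ∈ S, f u ∈ R u) ∧
      ∀ u ∈ S, ∀ v ∈ S, H.adj u v → T.adj (f u) (f v) := by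
  obtain ⟨⟨-, -, hL, hc1L, hc2L, hc12, hSeq, hpos12⟩, hbefore, hadj1, hadj2, hadj21, hb⟩ := hS
  have hsize : ∀ {L : Finset (Fin h)} {X Y : Finset (Fin n)},
      (h + 1) * (δ * W.card) ≤ (Y.card : ℝ) → (Y.card : ℝ) ≤ X.card + L.card * (δ * W.card) →
      δ * W.card ≤ X.card := by
    intro L X Y h1 h2
    have h3 : (L.card : ℝ) ≤ h := by
      exact_mod_cast (card_le_univ _).trans (Fintype.card_fin h).le
    have h4 := mul_le_mul_of_nonneg_right h3 (show 0 ≤ δ * (W.card : ℝ) by positivity)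
    linarith
  obtain ⟨X₁, hX₁, hX₁c, hX₁g⟩ := hcrit.exists_good_centers (R c₁) hc₁ L₁ R (fun _ => True)
    fun i hi => by
      obtain ⟨h1, h2, h3, h4, -⟩ := hleaf i (mem_union_left _ hi)
      exact ⟨h1, h2, h3, h4⟩
  obtain ⟨X₂, hX₂, hX₂c, hX₂g⟩ := hcrit.exists_good_centers (R c₂) hc₂ L₂ R (fun _ => True)
    fun i hi => by
      obtain ⟨h1, h2, h3, -, h4⟩ := hleaf i (mem_union_right _ hi)
      exact ⟨h1, h2, h3, h4⟩
  obtain ⟨v₁, hv₁, v₂, hv₂, hv⟩ := hcrit.exists_adj hδ (hX₁.trans hc₁) (hX₂.trans hc₂)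
    (hdisj.mono hX₁ hX₂) (hsize hcc₁ hX₁c) (hsize hcc₂ hX₂c)
  have : Nonempty (Fin n) := ⟨v₁⟩
  choose! g₁ hg₁R hg₁ _ using hX₁g v₁ hv₁
  choose! g₂ hg₂R hg₂ _ using hX₂g v₂ hv₂
  let f : Fin h → Fin n := fun i => if i = c₁ then v₁ else if i = c₂ then v₂ else
    if i ∈ L₁ then g₁ i else g₂ i
  have hfc₁ : f c₁ = v₁ := if_pos rfl
  have hfc₂ : f c₂ = v₂ := by
    change (if c₂ = c₁ then v₁ else if c₂ = c₂ then v₂ else _) = v₂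
    rw [if_neg hc12.symm, if_pos rfl]
  have hLne : ∀ i ∈ L₁ ∪ L₂, i ≠ c₁ ∧ i ≠ c₂ := fun i hi =>
    ⟨fun e => hc1L (e ▸ hi), fun e => hc2L (e ▸ hi)⟩
  have hfL₁ : ∀ i ∈ L₁, f i = g₁ i := fun i hi => by
    obtain ⟨h1, h2⟩ := hLne i (mem_union_left _ hi)
    change (if i = c₁ then v₁ else if i = c₂ then v₂ else if i ∈ L₁ then g₁ i else g₂ i) = _
    rw [if_neg h1, if_neg h2, if_pos hi]
  have hfL₂ : ∀ i ∈ L₂, f i = g₂ i := fun i hi => by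
    obtain ⟨h1, h2⟩ := hLne i (mem_union_right _ hi)
    change (if i = c₁ then v₁ else if i = c₂ then v₂ else if i ∈ L₁ then g₁ i else g₂ i) = _
    rw [if_neg h1, if_neg h2, if_neg fun h' => Finset.disjoint_left.mp hL h' hi]
  have hfL : ∀ i ∈ L₁ ∪ L₂, f i ∈ R i := by
    intro i hi
    rcases mem_union.mp hi with hi | hi
    · rw [hfL₁ i hi]
      exact hg₁R i hi
    · rw [hfL₂ i hi]
      exact hg₂R i hi
  have ha₁ : ∀ i ∈ L₁, T.adj v₁ (f i) := fun i hi => by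
    rw [hfL₁ i hi]
    exact hg₁ i hi trivial
  have ha₂ : ∀ i ∈ L₂, T.adj v₂ (f i) := fun i hi => by
    rw [hfL₂ i hi]
    exact hg₂ i hi trivial
  have hmemS : ∀ u ∈ S, u = c₁ ∨ u = c₂ ∨ u ∈ L₁ ∪ L₂ := fun u hu => by
    rw [hSeq] at hu
    simpa only [mem_insert] using hu
  refine ⟨f, fun u hu => ?_, fun i hi j hj hij => ?_⟩
  · rcases hmemS u hu with rfl | rfl | hu
    · rw [hfc₁]
      exact hX₁ hv₁
    · rw [hfc₂]
      exact hX₂ hv₂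
    · exact hfL u hu
  · have hne : i ≠ j := fun e => H.not_adj_self j (by simpa [e] using hij)
    rcases lt_or_gt_of_ne fun e => hne (pos_injective θ e) with hlt | hlt
    · rcases hmemS i hi with rfl | rfl | hiL
      · rcases hmemS j hj with rfl | rfl | hjL
        · exact absurd rfl hne
        · exact absurd hij (H.asymm _ _ hadj21)
        · exact absurd hlt (hbefore j hjL).not_gt
      · rcases hmemS j hj with rfl | rfl | hjL
        · exact absurd hlt hpos12.not_gt
        · exact absurd rfl hne
        · exact absurd (hlt.trans (hbefore j hjL)) hpos12.not_gt
      · have hiR := hfL i hiL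
        rcases hmemS j hj with rfl | rfl | hjL
        · rw [hfc₁]
          rcases mem_union.mp hiL with hi1 | hi2
          · exact absurd hij (H.asymm _ _ (hadj1 i hi1))
          · by_contra hcon
            exact htri i hiL (f i) hiR v₁ (hX₁ hv₁) v₂ (hX₂ hv₂)
              ⟨T.adj_of_not_adj (fun e => Finset.disjoint_left.mp (hleaf i hiL).2.2.2.1
                (hX₁ hv₁) (e ▸ hiR)) hcon, ha₂ i hi2, hv⟩
        · rw [hfc₂]
          rcases mem_union.mp hiL with hi1 | hi2
          · by_contra hcon
            exact htri i hiL (f i) hiR v₁ (hX₁ hv₁) v₂ (hX₂ hv₂)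
              ⟨ha₁ i hi1, T.adj_of_not_adj (fun e => Finset.disjoint_left.mp
                (hleaf i hiL).2.2.2.2 (hX₂ hv₂) (e ▸ hiR)) hcon, hv⟩
          · exact absurd hij (H.asymm _ _ (hadj2 i hi2))
        · exact hfwd i hiL j hjL hlt _ hiR _ (hfL j hjL)
    · rcases hb i hi j hj ⟨hij, hlt⟩ with ⟨rfl, h1⟩ | ⟨rfl, h1⟩ | ⟨rfl, rfl⟩
      · rw [hfc₁]
        exact ha₁ j h1
      · rw [hfc₂]
        exact ha₂ j h1
      · rw [hfc₁, hfc₂]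
        exact hv

/-- An index which is constant on the runs of consecutive vertices outside `Z`, and which
increases at every vertex of `Z`. -/
noncomputable def slot {h : ℕ} (θ : Equiv.Perm (Fin h)) (Z : Finset (Fin h)) (v : Fin h) : ℕ :=
  (Z.filter fun z => pos θ z < pos θ v).card + (Z.filter fun z => pos θ z ≤ pos θ v).card

theorem slot_le {h : ℕ} (θ : Equiv.Perm (Fin h)) (Z : Finset (Fin h)) (v : Fin h) :
    slot θ Z v ≤ 2 * h := by
  have h1 := (card_le_univ (Z.filter fun z => pos θ z < pos θ v)).trans (Fintype.card_fin h).le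
  have h2 := (card_le_univ (Z.filter fun z => pos θ z ≤ pos θ v)).trans (Fintype.card_fin h).le
  rw [slot]
  omega

theorem slot_lt {h : ℕ} (θ : Equiv.Perm (Fin h)) {Z : Finset (Fin h)} {u v z : Fin h}
    (huv : pos θ u < pos θ v) (hz : z ∈ Z) (huz : pos θ u ≤ pos θ z) (hzv : pos θ z ≤ pos θ v) :
    slot θ Z u < slot θ Z v := by
  have h1 : (Z.filter fun w => pos θ w < pos θ u).card ≤
      (Z.filter fun w => pos θ w < pos θ v).card :=
    card_le_card (monotone_filter_right _ fun w _ hw => lt_trans hw huv)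
  have h2 : (Z.filter fun w => pos θ w ≤ pos θ u).card ≤
      (Z.filter fun w => pos θ w ≤ pos θ v).card :=
    card_le_card (monotone_filter_right _ fun w _ hw => le_trans hw huv.le)
  rw [slot, slot]
  rcases lt_or_ge (pos θ z) (pos θ v) with h3 | h3
  · refine add_lt_add_of_lt_of_le (card_lt_card ?_) h2
    refine Finset.ssubset_iff_subset_ne.mpr
      ⟨monotone_filter_right _ fun w _ hw => lt_trans hw huv, fun e => ?_⟩
    have hmem : z ∈ Z.filter fun w => pos θ w < pos θ v := mem_filter.mpr ⟨hz, h3⟩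
    rw [← e] at hmem
    exact absurd (mem_filter.mp hmem).2 huz.not_gt
  · refine add_lt_add_of_le_of_lt h1 (card_lt_card ?_)
    refine Finset.ssubset_iff_subset_ne.mpr
      ⟨monotone_filter_right _ fun w _ hw => le_trans hw huv.le, fun e => ?_⟩
    have hmem : z ∈ Z.filter fun w => pos θ w ≤ pos θ v := mem_filter.mpr ⟨hz, hzv⟩
    rw [← e] at hmem
    exact absurd ((mem_filter.mp hmem).2.trans_lt huv) h3.not_gt

theorem slot_eq {h : ℕ} (θ : Equiv.Perm (Fin h)) {Z : Finset (Fin h)} {u v : Fin h}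
    (huv : pos θ u < pos θ v) (hZ : ∀ z ∈ Z, pos θ u ≤ pos θ z → pos θ z ≤ pos θ v → False) :
    slot θ Z u = slot θ Z v := by
  rw [slot, slot]
  congr 2
  · refine filter_congr fun z hz => ⟨fun h' => h'.trans huv, fun h' => ?_⟩
    by_contra! h1
    exact hZ z hz h1 h'.le
  · refine filter_congr fun z hz => ⟨fun h' => h'.trans huv.le, fun h' => ?_⟩
    by_contra! h1
    exact hZ z hz h1.le h'

theorem slot_le_slot {h : ℕ} (θ : Equiv.Perm (Fin h)) (Z : Finset (Fin h)) {u v : Fin h}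
    (huv : pos θ u < pos θ v) : slot θ Z u ≤ slot θ Z v := by
  by_cases hZ : ∃ z ∈ Z, pos θ u ≤ pos θ z ∧ pos θ z ≤ pos θ v
  · obtain ⟨z, hz, h1, h2⟩ := hZ
    exact (slot_lt θ huv hz h1 h2).le
  · exact (slot_eq θ huv fun z hz h1 h2 => hZ ⟨z, hz, h1, h2⟩).le

theorem slot_lt_of_mem {h : ℕ} (θ : Equiv.Perm (Fin h)) {Z : Finset (Fin h)} {u v : Fin h}
    (huv : pos θ u < pos θ v) (hZ : u ∈ Z ∨ v ∈ Z) : slot θ Z u < slot θ Z v := by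
  rcases hZ with hu | hv
  · exact slot_lt θ huv hu le_rfl huv.le
  · exact slot_lt θ huv hv huv.le le_rfl

theorem slot_lt_or_eq {h : ℕ} (θ : Equiv.Perm (Fin h)) (Z : Finset (Fin h)) {u v : Fin h}
    (huv : pos θ u < pos θ v) :
    slot θ Z u < slot θ Z v ∨ slot θ Z u = slot θ Z v ∧ u ∉ Z ∧ v ∉ Z := by
  rcases (slot_le_slot θ Z huv).lt_or_eq with h1 | h1
  · exact Or.inl h1
  · exact Or.inr ⟨h1, fun hu => (slot_lt_of_mem θ huv (Or.inl hu)).ne h1,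
      fun hv => (slot_lt_of_mem θ huv (Or.inr hv)).ne h1⟩

namespace LevelSystem

variable {n : ℕ} {T : Tournament n} {W : Finset (Fin n)} {τ : ℕ} {c μ : ℝ} {M P : ℕ}
  {B : ℕ → Option (Fin P) → Finset (Fin n)}

theorem nonempty (hB : T.LevelSystem W τ c μ M P B) (hc : 0 < c) (hW : 0 < W.card) (hτ : 0 < τ)
    {i : ℕ} (hi : i < M) (o : Option (Fin P)) : (B i o).Nonempty := by
  rw [← Finset.card_pos]
  have h1 : (0 : ℝ) < W.card := by exact_mod_cast hW
  have h2 : (0 : ℝ) < τ := by exact_mod_cast hτ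
  have h3 : (0 : ℝ) < (B i o).card := by
    cases o with
    | none => exact (mul_pos hc h1).trans_le (hB.card_linear i hi)
    | some p => exact (mul_pos hc h2).trans_le (hB.card_piece i hi p)
  exact_mod_cast h3

theorem le_card_of_linear (hB : T.LevelSystem W τ c μ M P B) {i : ℕ} (hi : i < M) {r : ℝ}
    (hr : r ≤ c / 4) {X : Finset (Fin n)} (hX : (B i none).card ≤ 4 * X.card) :
    r * (W.card : ℝ) ≤ X.card := by
  have h1 : ((B i none).card : ℝ) ≤ 4 * X.card := by exact_mod_cast hX
  have h2 := mul_le_mul_of_nonneg_right hr (Nat.cast_nonneg (α := ℝ) W.card)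
  have h3 := hB.card_linear i hi
  linarith

theorem le_card_of_piece (hB : T.LevelSystem W τ c μ M P B) {i : ℕ} (hi : i < M) {p : Fin P}
    {r : ℝ} (hr : r ≤ c / 4) {X : Finset (Fin n)} (hX : (B i (some p)).card ≤ 4 * X.card) :
    r * (τ : ℝ) ≤ X.card := by
  have h1 : ((B i (some p)).card : ℝ) ≤ 4 * X.card := by exact_mod_cast hX
  have h2 := mul_le_mul_of_nonneg_right hr (Nat.cast_nonneg (α := ℝ) τ)
  have h3 := hB.card_piece i hi p
  linarith

theorem disjoint_of_ne (hB : T.LevelSystem W τ c μ M P B) {i j : ℕ} (hi : i < M) (hj : j < M)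
    (hij : i ≠ j) (o o' : Option (Fin P)) : Disjoint (B i o) (B j o') := by
  rcases hij.lt_or_gt with h | h
  · exact hB.disjoint i j h hj o o'
  · exact (hB.disjoint j i h hi o' o).symm

theorem contains_superNebula (hB : T.LevelSystem W τ c μ M P B) {δ : ℝ}
    (hcrit : T.NearCritical W τ δ) {h m l d K : ℕ} {Nb : Tournament h} {θ : Equiv.Perm (Fin h)}
    {Q : Fin m → Finset (Fin h)} {ctr : Fin m → Fin h}
    {Sig : Fin l → Finset (Fin h)} {c₁ c₂ : Fin l → Fin h}
    {L₁ L₂ : Fin l → Finset (Fin h)} {kd : Fin l → NebKind}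
    (hN : SuperNebulaDecomp Nb θ Q ctr Sig c₁ c₂ L₁ L₂ kd)
    (hstars : ∀ i, Nb.IsOneRightMiddleStarAt θ (Q i) (ctr i) ∨ Nb.IsRightStarAt θ (Q i) (ctr i))
    (hkd : ∀ i, kd i = NebKind.left)
    (hc : 0 < c) (hW : 0 < W.card) (hτ : 0 < τ) (hμ : 0 ≤ μ) (hhμ : h * μ ≤ 1 / 2)
    (hδ : 0 < δ) (hδ' : δ ≤ 1 / 2) (hδc : (h + 1) * δ ≤ c / 4)
    (hK : 0 < K) (hM : K * (2 * h + 1) < M) (hP : d + h ≤ P)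
    (hno : ∀ t₁ t₂ t₃ : ℕ, t₁ < t₂ → t₂ < t₃ → t₃ ≤ 2 * h → ∀ p : Fin P, d ≤ p → (p : ℕ) < d + h →
      ∀ o₂ o₃, ∀ x ∈ B (K * (t₁ + 1)) (some p), ∀ y ∈ B (K * (t₂ + 1)) o₂,
      ∀ z ∈ B (K * (t₃ + 1)) o₃, ¬ (T.adj y x ∧ T.adj z x ∧ T.adj z y)) :
    T.Contains Nb := by
  obtain ⟨hQ, hSig, hQQ, hSS, hQS, hback, hbt, hbt'⟩ := hN
  have hn : 0 < n := by
    obtain ⟨w, -⟩ := Finset.card_pos.mp hW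
    exact w.pos
  have hW' : (0 : ℝ) < W.card := by exact_mod_cast hW
  have hδ1 : δ ≤ c / 4 := by
    have : (0 : ℝ) ≤ h * δ := by positivity
    linarith
  let Z : Finset (Fin h) := univ.image ctr ∪ (univ.image c₁ ∪ univ.image c₂)
  have hctrZ : ∀ i, ctr i ∈ Z := fun i => mem_union_left _ (mem_image_of_mem _ (mem_univ i))
  have hc₁Z : ∀ i, c₁ i ∈ Z := fun i =>
    mem_union_right _ (mem_union_left _ (mem_image_of_mem _ (mem_univ i)))
  have hc₂Z : ∀ i, c₂ i ∈ Z := fun i =>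
    mem_union_right _ (mem_union_right _ (mem_image_of_mem _ (mem_univ i)))
  have hZcases : ∀ z ∈ Z, (∃ i, z = ctr i) ∨ ∃ i, z = c₁ i ∨ z = c₂ i := by
    intro z hz
    simp only [Z, mem_union, mem_image, mem_univ, true_and] at hz
    rcases hz with ⟨i, hi⟩ | ⟨i, hi⟩ | ⟨i, hi⟩
    exacts [Or.inl ⟨i, hi.symm⟩, Or.inr ⟨i, Or.inl hi.symm⟩, Or.inr ⟨i, Or.inr hi.symm⟩]
  let lev : Fin h → ℕ := fun v => K * (slot θ Z v + 1)
  let κ : Fin h → Fin P := fun v => ⟨d + pos θ v, by have := (pos θ v).isLt; omega⟩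
  let o : Fin h → Option (Fin P) := fun v => if v ∈ Z then none else some (κ v)
  let R : Fin h → Finset (Fin n) := fun v => B (lev v) (o v)
  have hlevM : ∀ v, lev v < M := fun v =>
    (Nat.mul_le_mul_left K (Nat.succ_le_succ (slot_le θ Z v))).trans_lt hM
  have hlev : ∀ {u v}, slot θ Z u < slot θ Z v → lev u < lev v := fun huv =>
    Nat.mul_lt_mul_of_pos_left (Nat.succ_lt_succ huv) hK
  have hlevne : ∀ {u v}, u ≠ v → u ∈ Z → lev u ≠ lev v := by
    intro u v huv hu
    rcases lt_or_gt_of_ne fun e => huv (pos_injective θ e) with h1 | h1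
    · exact (hlev (slot_lt_of_mem θ h1 (Or.inl hu))).ne
    · exact (hlev (slot_lt_of_mem θ h1 (Or.inr hu))).ne'
  have hoZ : ∀ {v}, v ∈ Z → o v = none := fun hv => if_pos hv
  have hoN : ∀ {v}, v ∉ Z → o v = some (κ v) := fun hv => if_neg hv
  have hκ : ∀ {u v}, pos θ u < pos θ v → κ u < κ v := fun {u v} huv => by
    simp only [κ, Fin.lt_def] at huv ⊢
    omega
  have hchain : ∀ {u v}, pos θ u < pos θ v → slot θ Z u = slot θ Z v → u ∉ Z → v ∉ Z →
      ∀ x ∈ R u, ∀ y ∈ R v, T.adj x y := by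
    intro u v huv hslot hu hv x hx y hy
    simp only [R, hoN hu] at hx
    simp only [R, hoN hv, lev, ← hslot] at hy
    exact hB.chain _ (hlevM u) _ _ (hκ huv) x hx y hy
  have htri : ∀ {u v w : Fin h}, slot θ Z u < slot θ Z v → slot θ Z v < slot θ Z w → u ∉ Z →
      ∀ x ∈ R u, ∀ y ∈ R v, ∀ z ∈ R w, ¬ (T.adj y x ∧ T.adj z x ∧ T.adj z y) := by
    intro u v w huv hvw hu x hx y hy z hz
    simp only [R, hoN hu] at hx
    exact hno _ _ _ huv hvw (slot_le θ Z w) (κ u) (Nat.le_add_right _ _)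
      (Nat.add_lt_add_left (pos θ u).isLt _) _ _ x hx y hy z hz
  have hcard : ∀ {v} {X : Finset (Fin n)}, v ∈ Z → (R v).card ≤ 2 * X.card →
      (h + 1) * (δ * (W.card : ℝ)) ≤ X.card := by
    intro v X hv hX
    simp only [R, hoZ hv] at hX
    rw [← mul_assoc]
    exact hB.le_card_of_linear (hlevM v) hδc (by omega)
  have hcard' : ∀ {v} {X : Finset (Fin n)}, v ∉ Z → (R v).card ≤ 2 * X.card →
      δ * (τ : ℝ) ≤ X.card := by
    intro v X hv hX
    simp only [R, hoN hv] at hX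
    exact hB.le_card_of_piece (p := κ v) (hlevM v) hδ1 (by omega)
  have htrans : ∀ {v} {X : Finset (Fin n)}, v ∉ Z → X ⊆ R v → T.IsTransOn X := by
    intro v X hv hX
    simp only [R, hoN hv] at hX
    exact isTransOn_mono hX (hB.isTransOn _ (hlevM v) _)
  have hRW : ∀ v, R v ⊆ W := fun v => hB.subset _ (hlevM v) _
  have hRdisj : ∀ {u v}, u ≠ v → u ∈ Z → Disjoint (R u) (R v) := fun huv hu =>
    hB.disjoint_of_ne (hlevM _) (hlevM _) (hlevne huv hu) _ _
  let D : Fin m ⊕ Fin l → Finset (Fin h) := Sum.elim Q Sig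
  refine contains_of_parts (θ := θ) D ?_ ?_ R μ hμ hhμ hn
    (fun v => hB.nonempty hc hW hτ (hlevM v) _) ?_ ?_
  · rintro (i | i) (j | j) hij
    · exact hQQ i j fun e => hij (congrArg _ e)
    · exact hQS i j
    · exact (hQS j i).symm
    · exact hSS i j fun e => hij (congrArg _ e)
  · intro u v huv
    rcases hback u v huv with ⟨i, hi⟩ | ⟨i, hi⟩
    exacts [⟨Sum.inl i, hi⟩, ⟨Sum.inr i, hi⟩]
  · intro u v huv _
    rcases slot_lt_or_eq θ Z huv with h1 | ⟨h1, hu, hv⟩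
    · exact hB.smooth _ _ (hlev h1) (hlevM v) _ _
    · exact smooth_of_complete hμ (hchain huv h1 hu hv)
  · rintro (i | i) R' hR'
    · have hcQ : ctr i ∈ Q i := by
        rcases hstars i with h1 | h1
        exacts [h1.1.1, h1.1]
      have hleafZ : ∀ v ∈ (Q i).erase (ctr i), v ∉ Z := by
        intro v hv hvZ
        obtain ⟨hne, hvQ⟩ := mem_erase.mp hv
        rcases hZcases v hvZ with ⟨j, rfl⟩ | ⟨j, hj⟩
        · rcases eq_or_ne i j with rfl | hij
          · exact hne rfl
          · refine disjoint_left.mp (hQQ i j hij) hvQ ?_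
            rcases hstars j with h1 | h1
            exacts [h1.1.1, h1.1]
        · refine disjoint_left.mp (hQS i j) hvQ ?_
          have h2 := hSig j
          rw [hkd j] at h2
          rw [h2.1.2.2.2.2.2.2.1]
          rcases hj with rfl | rfl <;> simp
      have hc' := hR' (ctr i) hcQ
      refine hcrit.exists_star hδ.le (hQ i) R' (hc'.1.trans (hRW _)) ?_ ?_ ?_
      · have h1 := hcard (hctrZ i) hc'.2
        have h2 : 0 < δ * (W.card : ℝ) := by positivity
        linarith
      · intro v hv
        have hv' := hR' v (mem_of_mem_erase hv)
        have hvZ := hleafZ v hv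
        exact ⟨hv'.1.trans (hRW v), htrans hvZ hv'.1, hcard' hvZ hv'.2,
          (hRdisj (ne_of_mem_erase hv).symm (hctrZ i)).mono hc'.1 hv'.1⟩
      · intro u hu v hv huv w hw x hx y hy hux hxu hvy hyv
        have hx := (hR' u (mem_of_mem_erase hu)).1 hx
        have hy := (hR' v (mem_of_mem_erase hv)).1 hy
        have hw := hc'.1 hw
        rcases slot_lt_or_eq θ Z huv with h1 | ⟨h1, hu', hv'⟩
        swap
        · exact hchain huv h1 hu' hv' x hx y hy
        by_contra hxy
        have hne : x ≠ y := fun e =>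
          disjoint_left.mp (hB.disjoint _ _ (hlev h1) (hlevM v) _ _) hx (e ▸ hy)
        have hyx := adj_of_not_adj T hne hxy
        have hpne : ∀ {s}, s ∈ (Q i).erase (ctr i) → pos θ s ≠ pos θ (ctr i) := fun hs e =>
          ne_of_mem_erase hs (pos_injective θ e)
        rcases lt_or_gt_of_ne (hpne hu) with hu1 | hu1
        · rcases lt_or_gt_of_ne (hpne hv) with hv1 | hv1
          · exact htri h1 (slot_lt_of_mem θ hv1 (Or.inr (hctrZ i))) (hleafZ u hu) x hx y hy w hw
              ⟨hyx, hux hu1, hvy hv1⟩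
          · exact htri (slot_lt_of_mem θ hu1 (Or.inr (hctrZ i)))
              (slot_lt_of_mem θ hv1 (Or.inl (hctrZ i))) (hleafZ u hu) x hx w hw y hy
              ⟨hux hu1, hyx, hyv hv1⟩
        · rcases hstars i with hs | hs
          · have h2 := Finset.card_le_one.mp hs.2.le u (mem_filter.mpr ⟨hu, hu1⟩) v
              (mem_filter.mpr ⟨hv, lt_trans hu1 huv⟩)
            exact huv.ne (congrArg _ h2)
          · exact hu1.not_gt (hs.2.2.1 u hu).1
    · have hS := hSig i
      rw [hkd i] at hS
      obtain ⟨⟨-, -, -, hc₁L, hc₂L, hcne, hSeq, hcc⟩, hpos, -⟩ := id hS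
      have hLS : ∀ v ∈ L₁ i ∪ L₂ i, v ∈ Sig i := fun v hv => by
        rw [hSeq]
        exact mem_insert_of_mem (mem_insert_of_mem hv)
      have hc₁S : c₁ i ∈ Sig i := by rw [hSeq]; exact mem_insert_self _ _
      have hc₂S : c₂ i ∈ Sig i := by rw [hSeq]; simp
      have hleafZ : ∀ v ∈ L₁ i ∪ L₂ i, v ∉ Z := by
        intro v hv hvZ
        rcases hZcases v hvZ with ⟨j, rfl⟩ | ⟨j, hj⟩
        · refine disjoint_left.mp (hQS j i) ?_ (hLS _ hv)
          rcases hstars j with h1 | h1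
          exacts [h1.1.1, h1.1]
        · rcases eq_or_ne i j with rfl | hij
          · rcases hj with rfl | rfl
            exacts [hc₁L hv, hc₂L hv]
          · refine disjoint_left.mp (hSS i j hij) (hLS v hv) ?_
            have h2 := hSig j
            rw [hkd j] at h2
            rw [h2.1.2.2.2.2.2.2.1]
            rcases hj with rfl | rfl <;> simp
      have hslot : ∀ u ∈ L₁ i ∪ L₂ i, ∀ v ∈ L₁ i ∪ L₂ i, pos θ u < pos θ v →
          slot θ Z u = slot θ Z v := by
        intro u hu v hv huv
        refine slot_eq θ huv fun z hz huz hzv => ?_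
        have hb : BetweenSet θ (L₁ i ∪ L₂ i) z :=
          ⟨u, hu, v, hv, huz.lt_of_ne fun e => hleafZ u hu (pos_injective θ e ▸ hz),
            hzv.lt_of_ne fun e => hleafZ v hv (pos_injective θ e ▸ hz)⟩
        rcases hZcases z hz with ⟨j, rfl⟩ | ⟨j, hj⟩
        · exact hbt j i hb
        · rcases eq_or_ne j i with rfl | hij
          · have h1 := hpos v hv
            rcases hj with rfl | rfl
            exacts [hzv.not_gt h1, hzv.not_gt (lt_trans h1 hcc)]
          · rcases hj with rfl | rfl
            exacts [(hbt' j i hij).1 hb, (hbt' j i hij).2 hb]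
      have h₁ := hR' (c₁ i) hc₁S
      have h₂ := hR' (c₂ i) hc₂S
      refine hcrit.exists_superLeft hδ.le hδ' hS R' (h₁.1.trans (hRW _)) (h₂.1.trans (hRW _))
        (hcard (hc₁Z i) h₁.2) (hcard (hc₂Z i) h₂.2)
        ((hRdisj hcne (hc₁Z i)).mono h₁.1 h₂.1) ?_ ?_ ?_
      · intro v hv
        have hv' := hR' v (hLS v hv)
        have hvZ := hleafZ v hv
        exact ⟨hv'.1.trans (hRW v), htrans hvZ hv'.1, hcard' hvZ hv'.2,
          (hRdisj (fun e : c₁ i = v => hvZ (e ▸ hc₁Z i)) (hc₁Z i)).mono h₁.1 hv'.1,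
          (hRdisj (fun e : c₂ i = v => hvZ (e ▸ hc₂Z i)) (hc₂Z i)).mono h₂.1 hv'.1⟩
      · intro u hu v hv huv x hx y hy
        exact hchain huv (hslot u hu v hv huv) (hleafZ u hu) (hleafZ v hv) x
          ((hR' u (hLS u hu)).1 hx) y ((hR' v (hLS v hv)).1 hy)
      · intro u hu x hx y hy z hz
        exact htri (slot_lt_of_mem θ (hpos u hu) (Or.inr (hc₁Z i)))
          (slot_lt_of_mem θ hcc (Or.inr (hc₂Z i))) (hleafZ u hu) x ((hR' u (hLS u hu)).1 hx)
          y (h₁.1 hy) z (h₂.1 hz)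

end LevelSystem

theorem card_le_two_mul_card_of_avoid {n : ℕ} {ι : Type*} {A : Finset ι}
    {X X' : Finset (Fin n)} {μ : ℝ} (bad : ι → Finset (Fin n)) (hA : A.card * μ ≤ 1 / 2)
    (hbad : ∀ q ∈ A, ((bad q).card : ℝ) ≤ μ * X.card)
    (hX : ∀ w ∈ X, (∀ q ∈ A, w ∉ bad q) → w ∈ X') : X.card ≤ 2 * X'.card := by
  have h1 : X ⊆ X' ∪ A.biUnion bad := by
    intro w hw
    by_cases h2 : ∀ q ∈ A, w ∉ bad q
    · exact mem_union_left _ (hX w hw h2)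
    · push Not at h2
      exact mem_union_right _ (mem_biUnion.mpr h2)
  have h2 : (X.card : ℝ) ≤ X'.card + ∑ q ∈ A, ((bad q).card : ℝ) := by
    exact_mod_cast (card_le_card h1).trans
      ((card_union_le _ _).trans (Nat.add_le_add_left card_biUnion_le _))
  have h3 := sum_le_sum hbad
  rw [sum_const, nsmul_eq_mul, ← mul_assoc] at h3
  have h4 := mul_le_mul_of_nonneg_right hA (Nat.cast_nonneg (α := ℝ) X.card)
  have h5 : (X.card : ℝ) ≤ 2 * X'.card := by linarith
  exact_mod_cast h5

theorem exists_labelling {h P : ℕ} (α : Equiv.Perm (Fin h)) (a : Fin h) {p : Fin P}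
    (hp : h ≤ p) (hpP : (p : ℕ) + h < P) :
    ∃ κ : Fin h → Fin P, κ a = p ∧ ∀ {u v}, pos α u < pos α v → κ u < κ v := by
  let t : ℕ → ℕ := fun i => if i < pos α a then i else if i = pos α a then p else P - h + i
  have ha := (pos α a).isLt
  refine ⟨fun v => ⟨t (pos α v), ?_⟩, ?_, ?_⟩
  · have hv := (pos α v).isLt
    simp only [t]
    split_ifs <;> omega
  · simp only [t, lt_irrefl, if_false, if_true]
  · intro u v huv
    have hu := (pos α u).isLt
    have hv := (pos α v).isLt
    simp only [t, Fin.lt_def] at huv ⊢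
    split_ifs <;> omega

theorem LevelSystem.contains_triangularGalaxy {n : ℕ} {T : Tournament n} {W : Finset (Fin n)}
    {τ : ℕ} {c' μ : ℝ} {M P : ℕ} {B : ℕ → Option (Fin P) → Finset (Fin n)}
    (hB : T.LevelSystem W τ c' μ M P B) {δ : ℝ} (hcrit : T.NearCritical W τ δ)
    {h k : ℕ} {G : Tournament h} {α : Equiv.Perm (Fin h)} {a b c : Fin h}
    {Q : Fin k → Finset (Fin h)} {ctr : Fin k → Fin h}
    (hG : TriGalaxyDecomp G α (fun _ : Fin 1 => a) (fun _ => b) (fun _ => c) Q ctr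
      (fun _ => ({b, c} : Finset (Fin h))))
    (hc' : 0 < c') (hW : 0 < W.card) (hτ : 0 < τ) (hμ : 0 ≤ μ) (hhμ : h * (2 * μ) ≤ 1 / 2)
    (hμ3 : 3 * μ ≤ 1 / 2) (hδ : 0 < δ) (hδc : (h + 1) * δ ≤ c' / 4)
    {i₁ i₂ i₃ : ℕ} (hi₁ : 2 * h ≤ i₁) (hi₂ : i₁ + 2 * h < i₂) (hi₃ : i₂ + 2 * h < i₃)
    (hM : i₃ + 2 * h < M) {p : Fin P} (hp : h ≤ p) (hpP : (p : ℕ) + h < P)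
    {o₂ o₃ : Option (Fin P)} {x y z : Fin n} (hx : x ∈ B i₁ (some p)) (hy : y ∈ B i₂ o₂)
    (hz : z ∈ B i₃ o₃) (hxyz : T.adj y x ∧ T.adj z x ∧ T.adj z y) :
    T.Contains G := by
  obtain ⟨hΔ, hQ, -, hΔQ, hQQ, hback, hbt, hbt'⟩ := hG
  obtain ⟨hab, hbc, hba, hca, hcb⟩ := hΔ 0
  have hΔQ := hΔQ 0
  have hbt' := hbt' 0
  simp only at hab hbc hba hca hcb hΔQ hbt'
  let A : Finset (Fin h) := {a, b, c}
  have haA : a ∈ A := by simp [A]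
  have hbA : b ∈ A := by simp [A]
  have hcA : c ∈ A := by simp [A]
  have hA : ∀ v ∈ A, v = a ∨ v = b ∨ v = c := fun v hv => by simpa [A] using hv
  have hba' : b ≠ a := fun e => hab.ne (by rw [e])
  have hca' : c ≠ a := fun e => (hab.trans hbc).ne (by rw [e])
  have hcb' : c ≠ b := fun e => hbc.ne (by rw [e])
  have hW' : (0 : ℝ) < W.card := by exact_mod_cast hW
  have hδ1 : δ ≤ c' / 4 := by
    have : (0 : ℝ) ≤ h * δ := by positivity
    linarith
  let Z : Finset (Fin h) := {b, c} ∪ univ.image ctr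
  have hbZ : b ∈ Z := by simp [Z]
  have hcZ : c ∈ Z := by simp [Z]
  have hctrZ : ∀ j, ctr j ∈ Z := fun j => mem_union_right _ (mem_image_of_mem _ (mem_univ j))
  have hZcases : ∀ v ∈ Z, v ∈ ({b, c} : Finset (Fin h)) ∨ ∃ j, v = ctr j := by
    intro v hv
    rcases mem_union.mp hv with h1 | h1
    · exact Or.inl h1
    · obtain ⟨j, -, hj⟩ := mem_image.mp h1
      exact Or.inr ⟨j, hj.symm⟩
  have hctrQ : ∀ j, ctr j ∈ Q j := fun j => by
    rcases hQ j with h1 | h1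
    exacts [h1.1, h1.1]
  have hQA : ∀ {j v}, v ∈ Q j → v ∉ A := fun {j v} hv hvA => disjoint_left.mp (hΔQ j) hvA hv
  have haZ : a ∉ Z := by
    intro ha
    rcases hZcases a ha with h1 | ⟨j, hj⟩
    · rcases mem_insert.mp h1 with h2 | h2
      exacts [hba' h2.symm, hca' (mem_singleton.mp h2).symm]
    · exact hQA (hctrQ j) (hj ▸ haA)
  let σ : Fin h → ℕ := slot α Z
  have hσ : ∀ v, σ v ≤ 2 * h := slot_le α Z
  have hσab : σ a < σ b := slot_lt_of_mem α hab (Or.inr hbZ)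
  have hσbc : σ b < σ c := slot_lt_of_mem α hbc (Or.inr hcZ)
  let lev : Fin h → ℕ := fun v =>
    if σ v < σ b then i₁ + σ v - σ a else if σ v < σ c then i₂ + σ v - σ b else i₃ + σ v - σ c
  have hlevM : ∀ v, lev v < M := by
    intro v
    have h1 := hσ v
    simp only [lev]
    split_ifs <;> omega
  have hlev : ∀ {u v}, σ u < σ v → lev u < lev v := by
    intro u v huv
    have h1 := hσ u
    have h2 := hσ v
    have h3 := hσ a
    have h4 := hσ b
    have h5 := hσ c
    simp only [lev]
    split_ifs <;> omega
  have hleva : lev a = i₁ := by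
    simp only [lev, if_pos hσab]
    omega
  have hlevb : lev b = i₂ := by
    simp only [lev, lt_irrefl, if_false, if_pos hσbc]
    omega
  have hlevc : lev c = i₃ := by
    simp only [lev, lt_irrefl, if_false, if_neg hσbc.not_gt]
    omega
  have hlev_eq : ∀ {u v}, σ u = σ v → lev u = lev v := fun huv => by simp only [lev, huv]
  clear_value lev
  obtain ⟨κ, hκa, hκ⟩ := exists_labelling α a hp hpP
  let o : Fin h → Option (Fin P) := fun v =>
    if v = b then o₂ else if v = c then o₃ else if v ∈ Z then none else some (κ v)
  have hoZ : ∀ {v}, v ∉ A → v ∈ Z → o v = none := by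
    intro v hvA hvZ
    have h1 : v ≠ b := fun e => hvA (e ▸ hbA)
    have h2 : v ≠ c := fun e => hvA (e ▸ hcA)
    simp only [o, if_neg h1, if_neg h2, if_pos hvZ]
  have hoN : ∀ {v}, v ∉ Z → o v = some (κ v) := by
    intro v hvZ
    have h1 : v ≠ b := fun e => hvZ (e ▸ hbZ)
    have h2 : v ≠ c := fun e => hvZ (e ▸ hcZ)
    simp only [o, if_neg h1, if_neg h2, if_neg hvZ]
  let S : Fin h → Finset (Fin n) := fun v => B (lev v) (o v)
  have hSB : ∀ v, S v = B (lev v) (o v) := fun _ => rfl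
  have hSZ : ∀ {v}, v ∉ A → v ∈ Z → S v = B (lev v) none := fun hvA hvZ =>
    congrArg (B _) (hoZ hvA hvZ)
  have hSN : ∀ {v}, v ∉ Z → S v = B (lev v) (some (κ v)) := fun hvZ => congrArg (B _) (hoN hvZ)
  let g : Fin h → Fin n := fun v => if v = a then x else if v = b then y else z
  have hga : g a = x := if_pos rfl
  have hgb : g b = y := by simp only [g, if_neg hba', if_true]
  have hgc : g c = z := by simp only [g, if_neg hca', if_neg hcb']
  have hgS : ∀ v ∈ A, g v ∈ S v := by
    intro v hv
    rcases hA v hv with rfl | rfl | rfl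
    · rwa [hSN haZ, hleva, hκa, hga]
    · have h1 : o v = o₂ := if_pos rfl
      simp only [S, hlevb, h1, hgb, hy]
    · have h1 : o v = o₃ := by simp only [o, if_neg hcb', if_true]
      simp only [S, hlevc, h1, hgc, hz]
  clear_value g
  have hchain : ∀ {u v}, pos α u < pos α v → σ u = σ v → u ∉ Z → v ∉ Z →
      ∀ x ∈ S u, ∀ y ∈ S v, T.adj x y := by
    intro u v huv hslot hu hv x hx y hy
    rw [hSN hu] at hx
    rw [hSN hv, ← hlev_eq hslot] at hy
    exact hB.chain _ (hlevM u) _ _ (hκ huv) x hx y hy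
  have hsm : ∀ {u v}, pos α u < pos α v → T.Smooth μ (S u) (S v) := by
    intro u v huv
    rcases slot_lt_or_eq α Z huv with h1 | ⟨h1, hu, hv⟩
    · exact hB.smooth _ _ (hlev h1) (hlevM v) _ _
    · exact smooth_of_complete hμ (hchain huv h1 hu hv)
  let F : Fin h → Finset (Fin n) := fun v => (S v).filter fun w =>
    ∀ q ∈ A, (pos α v < pos α q → T.adj w (g q)) ∧ (pos α q < pos α v → T.adj (g q) w)
  have hFS : ∀ v, F v ⊆ S v := fun v => filter_subset _ _
  have hFmem : ∀ {v w}, w ∈ F v ↔ w ∈ S v ∧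
      ∀ q ∈ A, (pos α v < pos α q → T.adj w (g q)) ∧ (pos α q < pos α v → T.adj (g q) w) :=
    mem_filter
  have hSW : ∀ v, S v ⊆ W := fun v => hB.subset _ (hlevM v) _
  clear_value F S
  have hFcard : ∀ v ∉ A, (S v).card ≤ 2 * (F v).card := by
    intro v hv
    have hA3 : (A.card : ℝ) ≤ 3 := by exact_mod_cast card_le_three
    refine card_le_two_mul_card_of_avoid (A := A) (μ := μ) (fun q =>
      if pos α v < pos α q then (S v).filter fun w => ¬ T.adj w (g q)
      else (S v).filter fun w => ¬ T.adj (g q) w)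
      ((mul_le_mul_of_nonneg_right hA3 hμ).trans hμ3) (fun q hq => ?_) fun w hw hbad => ?_
    · have hvq : pos α v ≠ pos α q := fun e => hv (pos_injective α e ▸ hq)
      rcases lt_or_gt_of_ne hvq with h1 | h1
      · simp only [if_pos h1]
        exact (hsm h1).2 (g q) (hgS q hq)
      · simp only [if_neg h1.not_gt]
        exact (hsm h1).1 (g q) (hgS q hq)
    · refine hFmem.mpr ⟨hw, fun q hq => ⟨fun h1 => ?_, fun h1 => ?_⟩⟩
      · by_contra h2
        exact hbad q hq (by simp only [if_pos h1, mem_filter, hw, h2, not_false_eq_true, true_and])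
      · by_contra h2
        exact hbad q hq
          (by simp only [if_neg h1.not_gt, mem_filter, hw, h2, not_false_eq_true, true_and])
  let R : Fin h → Finset (Fin n) := fun v => if v ∈ A then {g v} else F v
  have hRA : ∀ {v}, v ∈ A → R v = {g v} := fun hv => if_pos hv
  have hRN : ∀ {v}, v ∉ A → R v = F v := fun hv => if_neg hv
  clear_value R
  let D : Option (Fin k) → Finset (Fin h) := fun i => i.elim A Q
  refine contains_of_parts (θ := α) D ?_ ?_ R (2 * μ) (by positivity) hhμ x.pos ?_ ?_ ?_
  · rintro (_ | i) (_ | j) hij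
    · exact absurd rfl hij
    · exact hΔQ j
    · exact (hΔQ i).symm
    · exact hQQ i j fun e => hij (congrArg _ e)
  · intro u v huv
    rcases hback u v huv with ⟨_, hi⟩ | ⟨i, hi⟩
    exacts [⟨none, hi⟩, ⟨some i, hi⟩]
  · intro v
    by_cases hv : v ∈ A
    · rw [hRA hv]
      exact singleton_nonempty _
    · rw [hRN hv, ← Finset.card_pos]
      have h1 := Finset.card_pos.mpr (hB.nonempty hc' hW hτ (hlevM v) (o v))
      have h2 := hFcard v hv
      rw [hSB] at h2
      omega
  · intro u v huv hnot
    by_cases hu : u ∈ A <;> by_cases hv : v ∈ A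
    · exact absurd ⟨none, hu, hv⟩ hnot
    · rw [hRA hu, hRN hv]
      refine smooth_of_complete (by positivity) fun s hs t ht => ?_
      rw [mem_singleton.mp hs]
      exact ((hFmem.mp ht).2 u hu).2 huv
    · rw [hRN hu, hRA hv]
      refine smooth_of_complete (by positivity) fun s hs t ht => ?_
      rw [mem_singleton.mp ht]
      exact ((hFmem.mp hs).2 v hv).1 huv
    · rw [hRN hu, hRN hv]
      exact (hsm huv).mono (r := 2) hμ (mul_comm _ _).le (hFS u) (hFS v)
        (by exact_mod_cast hFcard u hu) (by exact_mod_cast hFcard v hv)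
  · rintro (_ | j) R' hR'
    · refine ⟨g, fun u hu => ?_, fun u hu v hv huv => ?_⟩
      · obtain ⟨h1, h2⟩ := hR' u hu
        rw [hRA hu] at h1 h2
        have h3 : (R' u).Nonempty := by
          rw [← Finset.card_pos]
          rw [card_singleton] at h2
          omega
        obtain ⟨s, hs⟩ := h3
        rwa [← mem_singleton.mp (h1 hs)]
      · rcases hA u hu with rfl | rfl | rfl <;> rcases hA v hv with rfl | rfl | rfl
        · exact absurd huv (G.not_adj_self _)
        · exact absurd huv (G.asymm _ _ hba)
        · exact absurd huv (G.asymm _ _ hca)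
        · rw [hga, hgb]
          exact hxyz.1
        · exact absurd huv (G.not_adj_self _)
        · exact absurd huv (G.asymm _ _ hcb)
        · rw [hga, hgc]
          exact hxyz.2.1
        · rw [hgb, hgc]
          exact hxyz.2.2
        · exact absurd huv (G.not_adj_self _)
    · have hR'' : ∀ v ∈ Q j, R' v ⊆ S v ∧ (S v).card ≤ 4 * (R' v).card := by
        intro v hv
        obtain ⟨h1, h2⟩ := hR' v hv
        rw [hRN (hQA hv)] at h1 h2
        have h3 := hFcard v (hQA hv)
        exact ⟨h1.trans (hFS v), by omega⟩
      have hleafZ : ∀ v ∈ (Q j).erase (ctr j), v ∉ Z := by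
        intro v hv hvZ
        obtain ⟨hne, hvQ⟩ := mem_erase.mp hv
        rcases hZcases v hvZ with h1 | ⟨i, rfl⟩
        · exact hQA hvQ (mem_insert_of_mem h1)
        · rcases eq_or_ne i j with rfl | hij
          · exact hne rfl
          · exact disjoint_left.mp (hQQ i j hij) (hctrQ i) hvQ
      have hslot : ∀ u ∈ (Q j).erase (ctr j), ∀ v ∈ (Q j).erase (ctr j), pos α u < pos α v →
          σ u = σ v := by
        intro u hu v hv huv
        refine slot_eq α huv fun w hw huw hwv => ?_
        have hb : BetweenSet α ((Q j).erase (ctr j)) w :=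
          ⟨u, hu, v, hv, huw.lt_of_ne fun e => hleafZ u hu (pos_injective α e ▸ hw),
            hwv.lt_of_ne fun e => hleafZ v hv (pos_injective α e ▸ hw)⟩
        rcases hZcases w hw with h1 | ⟨i, rfl⟩
        · exact hbt' j w h1 hb
        · rcases eq_or_ne i j with rfl | hij
          · rcases hQ i with h1 | h1
            · exact huw.not_gt (h1.2.2.1 u hu).1
            · exact hwv.not_gt (h1.2.2.1 v hv).1
          · exact hbt i j hij hb
      have hstar : G.IsStarAt α (Q j) (ctr j) := by
        rcases hQ j with h1 | h1
        exacts [Or.inl h1, Or.inr (Or.inl h1)]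
      obtain ⟨hcS, hcc⟩ := hR'' (ctr j) (hctrQ j)
      refine hcrit.exists_star hδ.le hstar R' (hcS.trans (hSW _)) ?_ ?_ ?_
      · rw [hSZ (hQA (hctrQ j)) (hctrZ j)] at hcc
        have h1 := hB.le_card_of_linear (hlevM _) hδc hcc
        have h2 : 0 < δ * (W.card : ℝ) := by positivity
        linarith
      · intro v hv
        obtain ⟨h1, h2⟩ := hR'' v (mem_of_mem_erase hv)
        have hne : lev (ctr j) ≠ lev v := by
          rcases lt_or_gt_of_ne fun e => ne_of_mem_erase hv (pos_injective α e) with h3 | h3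
          · exact (hlev (slot_lt_of_mem α h3 (Or.inr (hctrZ j)))).ne'
          · exact (hlev (slot_lt_of_mem α h3 (Or.inl (hctrZ j)))).ne
        have hd := hB.disjoint_of_ne (hlevM _) (hlevM _) hne (o (ctr j)) (o v)
        rw [← hSB, ← hSB] at hd
        have hd := hd.mono hcS h1
        rw [hSN (hleafZ v hv)] at h1 h2
        exact ⟨h1.trans (hB.subset _ (hlevM v) _),
          isTransOn_mono h1 (hB.isTransOn _ (hlevM v) _),
          hB.le_card_of_piece (p := κ v) (hlevM v) hδ1 h2, hd⟩
      · intro u hu v hv huv w hw s hs t ht _ _ _ _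
        exact hchain huv (hslot u hu v hv huv) (hleafZ u hu) (hleafZ v hv)
          s ((hR'' u (mem_of_mem_erase hu)).1 hs) t ((hR'' v (mem_of_mem_erase hv)).1 ht)

end Embedding

end Tournament

theorem stmt2 {n₁ n₂ : ℕ} (Nb : Tournament n₁) (θ : Equiv.Perm (Fin n₁))
    {m l : ℕ} (Q : Fin m → Finset (Fin n₁)) (ctr : Fin m → Fin n₁)
    (Sig : Fin l → Finset (Fin n₁)) (c₁ c₂ : Fin l → Fin n₁)
    (L₁ L₂ : Fin l → Finset (Fin n₁)) (kd : Fin l → NebKind)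
    (hN : SuperNebulaDecomp Nb θ Q ctr Sig c₁ c₂ L₁ L₂ kd)
    (hstars : ∀ i, Nb.IsOneRightMiddleStarAt θ (Q i) (ctr i) ∨ Nb.IsRightStarAt θ (Q i) (ctr i))
    (hkd : ∀ i, kd i = NebKind.left)
    (G : Tournament n₂) (α : Equiv.Perm (Fin n₂)) (a b c : Fin n₂)
    {k : ℕ} (QG : Fin k → Finset (Fin n₂)) (ctrG : Fin k → Fin n₂)
    (hG : TriGalaxyDecomp G α (fun _ : Fin 1 => a) (fun _ => b) (fun _ => c) QG ctrG
      (fun _ => ({b, c} : Finset (Fin n₂)))) :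
    EHPair Nb G := by
  by_contra hEH
  have hK₁ : (0 : ℝ) < 4 * (n₁ + n₂ + 3) := by positivity
  obtain ⟨μ, hμ⟩ : ∃ μ : ℝ, μ * (4 * (n₁ + n₂ + 3)) = 1 :=
    ⟨(4 * ((n₁ : ℝ) + n₂ + 3))⁻¹, inv_mul_cancel₀ hK₁.ne'⟩
  have hμ0 : 0 < μ := pos_of_mul_pos_left (hμ ▸ one_pos) hK₁.le
  have h₁ : (0 : ℝ) ≤ n₁ * μ := by positivity
  have h₂ : (0 : ℝ) ≤ n₂ * μ := by positivity
  obtain ⟨ρ, hc0, hc2, hlev⟩ := exists_levelSystem Nb ((2 * n₂ + 1) * (2 * n₁ + 2))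
    (n₁ + 2 * n₂) μ hμ0
  obtain ⟨δ, hδ⟩ : ∃ δ : ℝ, δ * (4 * (n₁ + n₂ + 3)) = ρ :=
    ⟨ρ * (4 * ((n₁ : ℝ) + n₂ + 3))⁻¹, inv_mul_cancel_right₀ hK₁.ne' ρ⟩
  have hδ0 : 0 < δ := pos_of_mul_pos_left (hδ ▸ hc0) hK₁.le
  have h₃ : (0 : ℝ) ≤ n₁ * δ := by positivity
  have h₄ : (0 : ℝ) ≤ n₂ * δ := by positivity
  obtain ⟨s, hs⟩ := exists_nat_ge (1 / ρ)
  have hs1 : ∀ {w : ℕ}, s ≤ w → 1 ≤ ρ * (w : ℝ) := by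
    intro w hw
    rw [mul_comm, ← div_le_iff₀ hc0]
    exact hs.trans (by exact_mod_cast hw)
  have hs0 : 0 < s := by
    have : (0 : ℝ) < s := (div_pos one_pos hc0).trans_le hs
    exact_mod_cast this
  obtain ⟨n, T, W, τ, hTN, hTG, hcrit, hW, hτ⟩ :=
    exists_nearCritical Nb G hEH δ hδ0 (by linarith) s
  obtain ⟨B, hB⟩ := hlev n T W τ δ hTN (by linarith) hcrit (hs1 hW) (hs1 hτ)
  refine hTN (hB.contains_superNebula hcrit hN hstars hkd hc0 (hs0.trans_le hW) (hs0.trans_le hτ)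
    hμ0.le (by linarith) hδ0 (by linarith) (by linarith) (d := n₂) (K := 2 * n₂ + 1) (by omega)
    (Nat.mul_lt_mul_of_pos_left (by omega) (by omega)) (by omega) ?_)
  intro t₁ t₂ t₃ h12 h23 h3 p hp hp' o₂ o₃ x hx y hy z hz hxyz
  refine hTG (hB.contains_triangularGalaxy hcrit hG hc0 (hs0.trans_le hW) (hs0.trans_le hτ)
    hμ0.le (by linarith) (by linarith) hδ0 (by linarith) ?_ ?_ ?_ ?_ hp (by omega) hx hy hz hxyz)
  · nlinarith
  · nlinarith
  · nlinarith
  · nlinarith
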